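/- Let p ≡ 5 (mod 8) and d ≡ 3 (mod 4) be primes with (d/p) = -1 or p ≡ 5 (mod 8) holding (i.e., p ≡ 5 mod 8). Then the class number of the triquadratic field K₁ = Q(√p, √d, √2) is odd, and consequently the 2-Iwasawa module A(K_∞) of K = Q(√p, √d) is trivial. -/

import Mathlib

open NumberField

/-- The subfield of ℝ generated over ℚ by a set of real numbers. -/
noncomputable def Qadj (S : Set ℝ) : IntermediateField ℚ ℝ := IntermediateField.adjoin ℚ S

/-- The n-th layer of the cyclotomic Z₂-extension of the subfield of ℝ generated by `S`:
it is obtained by adjoining 2cos(2π/2^(n+2)). -/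
noncomputable def layer (S : Set ℝ) (n : ℕ) : IntermediateField ℚ ℝ :=
  IntermediateField.adjoin ℚ (S ∪ {2 * Real.cos (2 * Real.pi / 2 ^ (n + 2))})

section PartP1

/-! ### An index computation in an abelian group with an involution -/

/-- The squaring homomorphism. -/
def sqHom (G : Type*) [CommGroup G] : G →* G := powMonoidHom 2

/-- The norm homomorphism `x ↦ x * σ x`. -/
def nmHom {G : Type*} [CommGroup G] (σ : G →* G) : G →* G := MonoidHom.id G * σ

/-- The homomorphism `x ↦ σ x / x`. -/
def dfHom {G : Type*} [CommGroup G] (σ : G →* G) : G →* G := σ / MonoidHom.id G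

lemma sqHom_apply {G : Type*} [CommGroup G] (x : G) : sqHom G x = x * x := by
  simp [sqHom, pow_two]

lemma nmHom_apply {G : Type*} [CommGroup G] (σ : G →* G) (x : G) : nmHom σ x = x * σ x := rfl

lemma dfHom_apply {G : Type*} [CommGroup G] (σ : G →* G) (x : G) : dfHom σ x = σ x / x := rfl

lemma herbrand_aux {G : Type*} [CommGroup G] (σ : G →* G) (hσ : ∀ x, σ (σ x) = x)
    (e : G) (hee : e * e = 1) (hene : ∀ x : G, x * x ≠ e)
    (htors : ∀ x : G, x * x = 1 → x = 1 ∨ x = e)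
    (hG0 : (sqHom G).range.index ≠ 0)
    (hG : (sqHom G).range.index =
      (((dfHom σ).ker.map (sqHom G)).relIndex (dfHom σ).ker) ^ 2) :
    2 * (nmHom σ).range.relIndex (dfHom σ).ker = (dfHom σ).range.relIndex (nmHom σ).ker := by
  set U := (dfHom σ).ker with hU
  set V := (nmHom σ).ker with hV
  have memU : ∀ x, x ∈ U ↔ σ x = x := fun x => by
    rw [hU, MonoidHom.mem_ker, dfHom_apply, div_eq_one]
  have memV : ∀ x, x ∈ V ↔ x * σ x = 1 := fun x => by
    rw [hV, MonoidHom.mem_ker, nmHom_apply]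
  have he1 : e ≠ 1 := fun h => hene 1 (by rw [h, one_mul])
  have heσ : σ e = e := by
    have h1 : σ e * σ e = 1 := by rw [← map_mul, hee, map_one]
    rcases htors _ h1 with h | h
    · exact absurd (by rw [← hσ e, h, map_one]) he1
    · exact h
  have heU : e ∈ U := (memU e).2 heσ
  have heV : e ∈ V := (memV e).2 (by rw [heσ, hee])
  set U2 := U.map (sqHom G) with hU2
  set V2 := V.map (sqHom G) with hV2
  have hU2U : U2 ≤ U := by
    rintro _ ⟨x, hx, rfl⟩
    rw [sqHom_apply]; exact U.mul_mem hx hx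
  have hV2V : V2 ≤ V := by
    rintro _ ⟨x, hx, rfl⟩
    rw [sqHom_apply]; exact V.mul_mem hx hx
  have hU2' : U2 = U.map (nmHom σ) := by
    ext y
    simp only [hU2, Subgroup.mem_map]
    refine exists_congr fun x => and_congr_right fun hx => ?_
    rw [sqHom_apply, nmHom_apply, (memU x).1 hx]
  have hV2' : V2 = V.map (dfHom σ) := by
    ext y
    simp only [hV2, Subgroup.mem_map]
    have key : ∀ x ∈ V, dfHom σ x⁻¹ = sqHom G x := by
      intro x hx
      have : σ x = x⁻¹ := by rw [eq_inv_iff_mul_eq_one, mul_comm]; exact (memV x).1 hx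
      rw [dfHom_apply, sqHom_apply, map_inv, this]; simp
    constructor
    · rintro ⟨x, hx, rfl⟩
      exact ⟨x⁻¹, V.inv_mem hx, key x hx⟩
    · rintro ⟨x, hx, rfl⟩
      exact ⟨x⁻¹, V.inv_mem hx, by rw [← key _ (V.inv_mem hx), inv_inv]⟩
  have hNU : (nmHom σ).range ≤ U := by
    rintro _ ⟨x, rfl⟩
    rw [memU, nmHom_apply, map_mul, hσ, mul_comm]
  have hDV : (dfHom σ).range ≤ V := by
    rintro _ ⟨x, rfl⟩
    rw [memV, dfHom_apply, map_div, hσ]; simp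
  have hU2N : U2 ≤ (nmHom σ).range := by
    rw [hU2']; exact Subgroup.map_le_range _ _
  have hV2D : V2 ≤ (dfHom σ).range := by
    rw [hV2']; exact Subgroup.map_le_range _ _
  have e1 := Subgroup.relIndex_mul_relIndex _ _ _ hU2N hNU
  have e2 := Subgroup.relIndex_mul_relIndex _ _ _ hV2D hDV
  have e3 : U2.relIndex (nmHom σ).range = (U ⊔ V).index := by
    rw [hU2', MonoidHom.range_eq_map, Subgroup.relIndex_map_map, top_sup_eq,
      Subgroup.relIndex_top_right]
  have e4 : V2.relIndex (dfHom σ).range = (U ⊔ V).index := by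
    rw [hV2', MonoidHom.range_eq_map, Subgroup.relIndex_map_map, top_sup_eq,
      Subgroup.relIndex_top_right, sup_comm]
  set W := U ⊔ V with hW
  have hGW : (sqHom G).range ≤ W := by
    rintro _ ⟨x, rfl⟩
    have : sqHom G x = nmHom σ x * (dfHom σ x)⁻¹ := by
      rw [sqHom_apply, nmHom_apply, dfHom_apply]
      rw [inv_div, mul_div_assoc']
      rw [eq_div_iff_mul_eq']
      ac_rfl
    rw [this]
    exact Subgroup.mul_mem_sup (hNU ⟨x, rfl⟩) (V.inv_mem (hDV ⟨x, rfl⟩))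
  have hW0 : W.index ≠ 0 := fun h => hG0 (by
    rw [← Subgroup.relIndex_mul_index hGW, h, mul_zero])
  have hker : (sqHom G).ker ≤ W := by
    intro x hx
    rw [MonoidHom.mem_ker, sqHom_apply] at hx
    rcases htors x hx with rfl | rfl
    · exact W.one_mem
    · exact Subgroup.mem_sup_left heU
  set W2 := W.map (sqHom G) with hW2
  have hW2W : W2 ≤ W := by
    rintro _ ⟨x, hx, rfl⟩
    rw [sqHom_apply]; exact W.mul_mem hx hx
  have e5 : W2.relIndex (sqHom G).range = W.index := by
    rw [hW2, MonoidHom.range_eq_map, Subgroup.relIndex_map_map, top_sup_eq,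
      Subgroup.relIndex_top_right, sup_eq_left.2 hker]
  have e6 := Subgroup.relIndex_mul_index hW2W
  have e7 := Subgroup.relIndex_mul_index (show W2 ≤ (sqHom G).range from Subgroup.map_le_range _ _)
  have e8 : W2.relIndex W = (sqHom G).range.index := by
    rw [e5] at e7
    rw [← e7, mul_comm] at e6
    exact Nat.eq_of_mul_eq_mul_left (Nat.pos_of_ne_zero hW0) e6
  have hW2' : W2 = U2 ⊔ V2 := Subgroup.map_sup _ _ _
  have e9 := Subgroup.relIndex_mul_relIndex W2 (U ⊔ V2) W
    (by rw [hW2']; exact sup_le_sup_right hU2U _) (sup_le_sup_left hV2V _)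
  have hUV : ∀ x ∈ U, x ∈ V → x = 1 ∨ x = e := by
    intro x h1 h2
    apply htors
    have := (memV x).1 h2
    rwa [(memU x).1 h1] at this
  have e10 : W2.relIndex (U ⊔ V2) = U2.relIndex U := by
    have : U ⊔ V2 = U ⊔ W2 := by
      rw [hW2', ← sup_assoc, sup_eq_left.2 hU2U]
    rw [this, Subgroup.relIndex_sup_right, ← Subgroup.inf_relIndex_right]
    congr 1
    apply le_antisymm
    · rintro x ⟨hx, hxU⟩
      rw [hW2'] at hx
      obtain ⟨u, hu, v, hv, rfl⟩ := Subgroup.mem_sup.1 hx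
      have hvU : v ∈ U := by
        have := U.mul_mem (U.inv_mem (hU2U hu)) hxU
        simpa using this
      have : v = 1 := by
        rcases hUV v hvU (hV2V hv) with h | h
        · exact h
        · obtain ⟨w, -, hw⟩ := hv
          rw [sqHom_apply, h] at hw
          exact absurd hw (hene w)
      simpa [this] using hu
    · exact le_inf (by rw [hW2']; exact le_sup_left) hU2U
  have e11 : 2 * (U ⊔ V2).relIndex W = V2.relIndex V := by
    have : W = V ⊔ (U ⊔ V2) := by
      rw [sup_comm, sup_assoc, sup_eq_right.2 hV2V]
    rw [this, Subgroup.relIndex_sup_right, ← Subgroup.inf_relIndex_right]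
    have hle : V2 ≤ (U ⊔ V2) ⊓ V := le_inf le_sup_right hV2V
    rw [← Subgroup.relIndex_mul_relIndex _ _ _ hle inf_le_right]
    congr 1
    symm
    rw [Subgroup.relIndex_eq_two_iff]
    refine ⟨e, ⟨Subgroup.mem_sup_left heU, heV⟩, ?_⟩
    have heV2 : e ∉ V2 := by
      rintro ⟨w, -, hw⟩
      rw [sqHom_apply] at hw
      exact hene w hw
    rintro b ⟨hb, hbV⟩
    obtain ⟨u, hu, v, hv, rfl⟩ := Subgroup.mem_sup.1 hb
    have huV : u ∈ V := by
      have := V.mul_mem hbV (V.inv_mem (hV2V hv))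
      simpa using this
    rcases hUV u hu huV with rfl | rfl
    · right
      refine ⟨by simpa using hv, fun h => heV2 ?_⟩
      have := V2.mul_mem (V2.inv_mem hv) h
      simpa using this
    · left
      refine ⟨?_, fun h => heV2 ?_⟩
      · rw [mul_right_comm, hee, one_mul]; exact hv
      · have := V2.mul_mem h (V2.inv_mem hv)
        simpa using this
  rw [e10, e8, hG] at e9
  have ha : U2.relIndex U ≠ 0 := by
    intro h; rw [h] at hG; exact hG0 (by simpa using hG)
  have e12 : (U ⊔ V2).relIndex W = U2.relIndex U := by
    rw [pow_two] at e9
    exact Nat.eq_of_mul_eq_mul_left (Nat.pos_of_ne_zero ha) e9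
  rw [e12] at e11
  rw [← e11, e4, ← e1, e3] at e2
  apply Nat.eq_of_mul_eq_mul_left (Nat.pos_of_ne_zero hW0)
  rw [e2]; ring
end PartP1

section PartP2
open NumberField
open scoped Pointwise

section Quad
set_option linter.unusedSectionVars false
variable {K L : Type*} [Field K] [NumberField K] [Field L] [NumberField L] [Algebra K L]
  [IsGalois K L] (σ : Gal(L/K)) (hσ : ∀ g : Gal(L/K), g = 1 ∨ g = σ) (hσ1 : σ ≠ 1)

include hσ hσ1 in
lemma card_gal : Nat.card Gal(L/K) = 2 := by
  rw [Nat.card_eq_two_iff]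
  exact ⟨1, σ, hσ1.symm, by ext g; simp; exact hσ g⟩

include hσ hσ1 in
lemma sig_mul : σ * σ = 1 := by
  rcases hσ (σ * σ) with h | h
  · exact h
  · exact absurd (mul_eq_left.1 h) hσ1

include hσ in
lemma prime_trans (P Q : Ideal (𝓞 L)) [P.IsPrime] [Q.IsPrime]
    (h : P.under (𝓞 K) = Q.under (𝓞 K)) : Q = P ∨ Q = σ • P := by
  have : Q.LiesOver (P.under (𝓞 K)) := ⟨h⟩
  obtain ⟨g, hg⟩ := Ideal.exists_smul_eq_of_isGaloisGroup (P.under (𝓞 K)) P Q Gal(L/K)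
  rcases hσ g with rfl | rfl
  · left; rw [← hg, one_smul]
  · right; exact hg.symm

lemma under_smul (g : Gal(L/K)) (P : Ideal (𝓞 L)) :
    (g • P).under (𝓞 K) = P.under (𝓞 K) := by
  ext a
  rw [Ideal.under_def, Ideal.mem_comap, Ideal.under_def, Ideal.mem_comap,
    ← Ideal.smul_mem_pointwise_smul_iff (a := g⁻¹), inv_smul_smul, smul_algebraMap]

include hσ in
lemma primesOver_eq (P : Ideal (𝓞 L)) [P.IsPrime] :
    (P.under (𝓞 K)).primesOver (𝓞 L) = {P, σ • P} := by
  ext Q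
  constructor
  · rintro ⟨h1, h2⟩
    exact prime_trans σ hσ P Q h2.over
  · rintro (rfl | rfl)
    · exact ⟨inferInstance, ⟨rfl⟩⟩
    · exact ⟨inferInstance, ⟨(under_smul σ P).symm⟩⟩

include hσ hσ1 in
lemma tri (P : Ideal (𝓞 L)) [P.IsPrime] (hP : P ≠ ⊥) :
    (σ • P ≠ P ∧ (P.under (𝓞 K)).map (algebraMap (𝓞 K) (𝓞 L)) = P * σ • P) ∨
    (σ • P = P ∧ (P.under (𝓞 K)).map (algebraMap (𝓞 K) (𝓞 L)) = P) ∨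
    (σ • P = P ∧ (P.under (𝓞 K)).map (algebraMap (𝓞 K) (𝓞 L)) = P ^ 2 ∧
      ∀ x : 𝓞 L, σ • x - x ∈ P) := by
  classical
  set p := P.under (𝓞 K) with hp
  have hp0 : p ≠ ⊥ := Ideal.IsIntegral.comap_ne_bot _ hP
  have : p.IsMaximal := Ideal.IsPrime.isMaximal inferInstance hp0
  have hf := Ideal.ncard_primesOver_mul_ramificationIdxIn_mul_inertiaDegIn p (𝓞 L) Gal(L/K)
  have hprod := Ideal.map_algebraMap_eq_finsetProd_pow (R := 𝓞 L) (p := p) hp0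
  have hset := primesOver_eq σ hσ P
  have hin := Ideal.card_inertia_eq_ramificationIdxIn (G := Gal(L/K)) p P
  have hr : ∀ Q ∈ p.primesOver (𝓞 L), Q.ramificationIdx (𝓞 K) = p.ramificationIdxIn (𝓞 L) := by
    rintro Q ⟨h1, h2⟩
    exact (Ideal.ramificationIdxIn_eq_ramificationIdx p Q Gal(L/K)).symm
  have hprod' : Ideal.map (algebraMap (𝓞 K) (𝓞 L)) p =
      ∏ Q ∈ (p.primesOver (𝓞 L)).toFinset, Q ^ p.ramificationIdxIn (𝓞 L) := by
    rw [hprod]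
    exact Finset.prod_congr rfl fun Q hQ => by rw [hr Q (by simpa using hQ)]
  rw [card_gal σ hσ hσ1] at hf
  have hcard := Set.ncard_eq_toFinset_card' (p.primesOver (𝓞 L))
  have hset' : (p.primesOver (𝓞 L)).toFinset = {P, σ • P} := by
    ext Q; rw [Set.mem_toFinset, hset]; simp
  rw [hcard, hset'] at hf
  rw [hset'] at hprod'
  by_cases hs : σ • P = P
  · right
    rw [hs] at hf hprod'
    simp only [Finset.mem_singleton, Finset.insert_eq_of_mem, Finset.card_singleton, one_mul,
      Finset.prod_singleton] at hf hprod'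
    have hle : p.ramificationIdxIn (𝓞 L) ∣ 2 := ⟨_, hf.symm⟩
    rcases (Nat.dvd_prime Nat.prime_two).1 hle with h | h
    · left; exact ⟨hs, by rw [hprod', h, pow_one]⟩
    · right
      refine ⟨hs, by rw [hprod', h], fun x => ?_⟩
      rw [h] at hin
      have : P.inertia Gal(L/K) = ⊤ := by
        apply Subgroup.eq_top_of_card_eq
        rw [hin, card_gal σ hσ hσ1]
      have h2 : σ ∈ P.inertia Gal(L/K) := by rw [this]; trivial
      exact h2 x
  · left
    have hne : P ≠ σ • P := fun h => hs h.symm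
    rw [Finset.card_pair hne] at hf
    rw [Finset.prod_pair hne] at hprod'
    have h1 : p.ramificationIdxIn (𝓞 L) = 1 := by
      have : p.ramificationIdxIn (𝓞 L) * p.inertiaDegIn (𝓞 L) = 1 := by omega
      exact Nat.eq_one_of_mul_eq_one_right this
    exact ⟨hs, by rw [hprod', h1, pow_one, pow_one]⟩

include hσ hσ1 in
lemma smul_smul_sig {α : Type*} [MulAction Gal(L/K) α] (x : α) : σ • σ • x = x := by
  rw [smul_smul, sig_mul σ hσ hσ1, one_smul]

include hσ in
lemma exists_of_fixed (x : 𝓞 L) (hx : σ • x = x) : ∃ a : 𝓞 K, algebraMap (𝓞 K) (𝓞 L) a = x := by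
  apply Algebra.IsInvariant.isInvariant (G := Gal(L/K))
  intro g
  rcases hσ g with rfl | rfl
  · rw [one_smul]
  · exact hx

include hσ hσ1 in
/-- at a split prime the residue field does not grow -/
lemma split_residue (P : Ideal (𝓞 L)) [P.IsPrime] (hP : P ≠ ⊥) (hs : σ • P ≠ P) (x : 𝓞 L) :
    ∃ a : 𝓞 K, x - algebraMap (𝓞 K) (𝓞 L) a ∈ P := by
  have hPm : P.IsMaximal := Ideal.IsPrime.isMaximal inferInstance hP
  have hP2 : (σ • P) ≠ ⊥ := by
    intro h
    apply hP
    rw [← smul_smul_sig σ hσ hσ1 P, h]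
    exact Ideal.map_bot
  have hPm2 : (σ • P).IsMaximal := Ideal.IsPrime.isMaximal inferInstance hP2
  have hco : IsCoprime P (σ • P) := Ideal.isCoprime_iff_sup_eq.2 (Ideal.IsMaximal.coprime_of_ne hPm hPm2 (Ne.symm hs))
  obtain ⟨u, hu, v, hv, huv⟩ := Ideal.isCoprime_iff_exists.1 hco
  set y := x * v with hy
  have h1 : x - y ∈ P := by
    have : x - y = x * u := by rw [hy]; linear_combination (-x) * huv
    rw [this]; exact P.mul_mem_left _ hu
  have h2 : σ • y ∈ P := by
    have h3 : y ∈ σ • P := Ideal.mul_mem_left _ _ hv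
    have := Ideal.smul_mem_pointwise_smul σ _ _ h3
    rwa [smul_smul_sig σ hσ hσ1] at this
  obtain ⟨a, ha⟩ := exists_of_fixed σ hσ (y + σ • y) (by
    rw [smul_add, smul_smul_sig σ hσ hσ1, add_comm])
  refine ⟨a, ?_⟩
  rw [ha]
  have : x - (y + σ • y) = (x - y) - σ • y := by ring
  rw [this]
  exact P.sub_mem h1 h2

end Quad
end PartP2

section PartP3
open NumberField
open scoped Pointwise
open UniqueFactorizationMonoid

section Par
set_option linter.unusedSectionVars false
variable {K L : Type*} [Field K] [NumberField K] [Field L] [NumberField L] [Algebra K L]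
  [IsGalois K L] (σ : Gal(L/K)) (hσ : ∀ g : Gal(L/K), g = 1 ∨ g = σ) (hσ1 : σ ≠ 1)

/-- extension of ideals -/
noncomputable abbrev extI (L : Type*) {K : Type*} [Field K] [Field L] [Algebra K L]
    (J : Ideal (𝓞 K)) : Ideal (𝓞 L) := J.map (algebraMap (𝓞 K) (𝓞 L))

lemma ext_ne_bot {J : Ideal (𝓞 K)} (h : J ≠ ⊥) : extI L J ≠ ⊥ := Ideal.map_ne_bot_of_ne_bot h

/-- the ramified prime above a prime, or `⊤` -/
noncomputable def ramP (L : Type*) {K : Type*} [Field K] [Field L] [Algebra K L]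
    (p : Ideal (𝓞 K)) : Ideal (𝓞 L) :=
  open Classical in
  if h : ∃ P : Ideal (𝓞 L), P.IsPrime ∧ P ≠ ⊥ ∧ P.under (𝓞 K) = p ∧ extI L p = P ^ 2
    then h.choose else ⊤

/-- the parity of the multiplicity of the ramified prime -/
noncomputable def par {K L : Type*} [Field K] [Field L] [NumberField L] [Algebra K L]
    (I : Ideal (𝓞 L)) (p : Ideal (𝓞 K)) : ZMod 2 :=
  open Classical in ((normalizedFactors I).count (ramP L p) : ZMod 2)

lemma par_mul {I J : Ideal (𝓞 L)} (hI : I ≠ ⊥) (hJ : J ≠ ⊥) (p : Ideal (𝓞 K)) :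
    par (I * J) p = par I p + par J p := by
  classical
  simp only [par]
  rw [normalizedFactors_mul hI hJ, Multiset.count_add]
  push_cast
  rfl

lemma par_ext_prime (q p : Ideal (𝓞 K)) [hq : q.IsPrime] (hq0 : q ≠ ⊥) :
    par (extI L q) p = 0 := by
  classical
  by_cases h : ∃ P : Ideal (𝓞 L), P.IsPrime ∧ P ≠ ⊥ ∧ P.under (𝓞 K) = p ∧ extI L p = P ^ 2
  · have hP : ramP L p = h.choose := by rw [ramP, dif_pos h]
    obtain ⟨h1, h2, h3, h4⟩ := h.choose_spec
    rw [← hP] at h1 h2 h3 h4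
    by_cases hqp : q = p
    · rw [par, hqp, h4, normalizedFactors_pow,
        normalizedFactors_irreducible (Ideal.prime_of_isPrime h2 h1).irreducible]
      simp
      exact CharTwo.two_eq_zero
    · have : ramP L p ∉ normalizedFactors (extI L q) := by
        intro hm
        apply hqp
        have hdvd := dvd_of_mem_normalizedFactors hm
        have hle : q ≤ p := by
          rw [← h3]
          exact Ideal.map_le_iff_le_comap.1 (Ideal.le_of_dvd hdvd)
        have hqm : q.IsMaximal := Ideal.IsPrime.isMaximal hq hq0
        refine hqm.eq_of_le ?_ hle
        rw [← h3]
        exact (inferInstance : (Ideal.under (𝓞 K) (ramP L p)).IsPrime).ne_top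
      rw [par, Multiset.count_eq_zero_of_notMem this]; rfl
  · have hP : ramP L p = ⊤ := by rw [ramP, dif_neg h]
    have : ramP L p ∉ normalizedFactors (extI L q) := by
      intro hm
      have := (irreducible_of_normalized_factor _ hm).not_isUnit
      rw [hP] at this
      exact this (Ideal.isUnit_iff.2 rfl)
    rw [par, Multiset.count_eq_zero_of_notMem this]; rfl

lemma par_ext (J p : Ideal (𝓞 K)) (hJ : J ≠ ⊥) : par (extI L J) p = 0 := by
  classical
  induction J using UniqueFactorizationMonoid.induction_on_prime with
  | h₁ => exact absurd rfl hJ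
  | h₂ x hx =>
    have : x = ⊤ := Ideal.isUnit_iff.1 hx
    rw [this, par, extI, Ideal.map_top, ← Ideal.one_eq_top, normalizedFactors_one]
    simp
  | h₃ J q hJ0 hq ih =>
    have : q.IsPrime := Ideal.isPrime_of_prime hq
    have hq0 : q ≠ ⊥ := hq.ne_zero
    have : extI L (q * J) = extI L q * extI L J := Ideal.map_mul _ _ _
    rw [this, par_mul (ext_ne_bot hq0) (ext_ne_bot hJ0), ih hJ0, par_ext_prime q p hq0, add_zero]

lemma smul_ext (g : Gal(L/K)) (J : Ideal (𝓞 K)) : g • extI L J = extI L J := by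
  rw [Ideal.pointwise_smul_def, extI, Ideal.map_map]
  congr 1
  ext a
  simp

lemma smul_ne_bot (g : Gal(L/K)) {I : Ideal (𝓞 L)} (hI : I ≠ ⊥) : g • I ≠ ⊥ := by
  intro h
  apply hI
  rw [← inv_smul_smul g I, h]
  exact Ideal.map_bot

include hσ hσ1 in
lemma desc (T : Finset (Ideal (𝓞 K)))
    (hT : ∀ P : Ideal (𝓞 L), P.IsPrime → P ≠ ⊥ → P.under (𝓞 K) ∉ T → ∃ x : 𝓞 L, σ • x - x ∉ P)
    (n : ℕ) : ∀ (I : Ideal (𝓞 L)), I ≠ ⊥ → (normalizedFactors I).card = n → σ • I = I →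
      (∀ p ∈ T, par I p = 0) → ∃ J : Ideal (𝓞 K), J ≠ ⊥ ∧ extI L J = I := by
  classical
  induction n using Nat.strong_induction_on with
  | _ n ih =>
  intro I hI hn hs hpar
  by_cases hIt : I = ⊤
  · exact ⟨⊤, top_ne_bot, by rw [extI, Ideal.map_top, hIt]⟩
  obtain ⟨P, hPm, hIP⟩ := Ideal.exists_le_maximal I hIt
  have hPp : P.IsPrime := hPm.isPrime
  have hP0 : P ≠ ⊥ := fun h => hI (le_bot_iff.1 (h ▸ hIP))
  have hPI : P ∣ I := Ideal.dvd_iff_le.2 hIP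
  have hPprime : Prime P := Ideal.prime_of_isPrime hP0 hPp
  set p := P.under (𝓞 K) with hp
  have hp0 : p ≠ ⊥ := Ideal.IsIntegral.comap_ne_bot _ hP0
  have hE : extI L p ∣ I := by
    rcases tri σ hσ hσ1 P hP0 with ⟨h1, h2⟩ | ⟨h1, h2⟩ | ⟨h1, h2, h3⟩
    · rw [extI, h2]
      have hsP : σ • P ∣ I := by
        rw [Ideal.dvd_iff_le, ← hs]
        exact Ideal.pointwise_smul_le_pointwise_smul_iff.2 hIP
      have hsm : (σ • P).IsMaximal :=
        Ideal.IsPrime.isMaximal inferInstance (smul_ne_bot σ hP0)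
      exact IsCoprime.mul_dvd (Ideal.isCoprime_iff_sup_eq.2
        (Ideal.IsMaximal.coprime_of_ne hPm hsm (Ne.symm h1))) hPI hsP
    · rw [extI, h2]; exact hPI
    · have hpT : p ∈ T := by
        by_contra hc
        obtain ⟨x, hx⟩ := hT P hPp hP0 hc
        exact hx (h3 x)
      have hex : ∃ P : Ideal (𝓞 L), P.IsPrime ∧ P ≠ ⊥ ∧ P.under (𝓞 K) = p ∧ extI L p = P ^ 2 :=
        ⟨P, hPp, hP0, rfl, h2⟩
      have hram : ramP L p = P := by
        have hP : ramP L p = hex.choose := by rw [ramP, dif_pos hex]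
        obtain ⟨k1, k2, k3, k4⟩ := hex.choose_spec
        rw [← hP] at k1 k2 k3 k4
        rcases prime_trans σ hσ P (ramP L p) k3.symm with h | h
        · exact h
        · rw [h, h1]
      have hc := hpar p hpT
      rw [par, hram, ZMod.natCast_eq_zero_iff] at hc
      have hpos : 0 < (normalizedFactors I).count P := by
        rw [Multiset.count_pos]
        exact (mem_normalizedFactors_iff hI).2 ⟨hPprime, hPI⟩
      have h2le : 2 ≤ (normalizedFactors I).count P := Nat.le_of_dvd hpos hc
      rw [extI, h2]
      rw [dvd_iff_normalizedFactors_le_normalizedFactors (pow_ne_zero 2 hP0) hI,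
        normalizedFactors_pow, normalizedFactors_irreducible hPprime.irreducible, normalize_eq,
        Multiset.nsmul_singleton]
      exact Multiset.le_count_iff_replicate_le.1 h2le
  obtain ⟨I', hI'⟩ := hE
  have hE0 : extI L p ≠ ⊥ := ext_ne_bot hp0
  have hI'0 : I' ≠ ⊥ := by
    rintro rfl
    exact hI (by rw [hI', Ideal.mul_bot])
  have hs' : σ • I' = I' := by
    have : extI L p * (σ • I') = extI L p * I' := by
      rw [← hI', ← hs, hI', smul_mul', smul_ext]
    exact mul_left_cancel₀ hE0 this
  have hpar' : ∀ q ∈ T, par I' q = 0 := by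
    intro q hq
    have := hpar q hq
    rwa [hI', par_mul hE0 hI'0, par_ext _ _ hp0, zero_add] at this
  have hEc : 0 < (normalizedFactors (extI L p)).card := by
    rw [Multiset.card_pos]
    intro h0
    rw [normalizedFactors_eq_zero_iff hE0] at h0
    have h1 : extI L p = ⊤ := Ideal.isUnit_iff.1 h0
    have h2 : extI L p ≤ P := Ideal.map_le_iff_le_comap.2 le_rfl
    exact hPp.ne_top (top_le_iff.1 (h1 ▸ h2))
  have hcard : (normalizedFactors I).card =
      (normalizedFactors (extI L p)).card + (normalizedFactors I').card := by
    rw [hI', normalizedFactors_mul hE0 hI'0, Multiset.card_add]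
  obtain ⟨J, hJ0, hJ⟩ := ih _ (by omega) I' hI'0 rfl hs' hpar'
  refine ⟨p * J, mul_ne_zero hp0 hJ0, ?_⟩
  rw [hI', ← hJ]
  exact Ideal.map_mul _ _ _

end Par
end PartP3

section PartP4a
open NumberField

section Dir
variable (K : Type*) [Field K] [NumberField K] [IsTotallyReal K]

/-- a real embedding -/
noncomputable def rEmb : K →+* ℝ :=
  InfinitePlace.embedding_of_isReal (IsTotallyReal.isReal (Classical.arbitrary (InfinitePlace K)))

/-- sign of a unit under the chosen real embedding -/
noncomputable def sgnHom : (𝓞 K)ˣ →* SignTypeˣ :=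
  Units.map ((signHom (α := ℝ) : ℝ →* SignType).comp
    ((rEmb K : K →* ℝ).comp ((algebraMap (𝓞 K) K : 𝓞 K →* K))))

/-- exponents -/
noncomputable def expo (u : (𝓞 K)ˣ) : Fin (Units.rank K) → ℤ :=
  (Units.exist_unique_eq_mul_prod K u).choose.2

lemma expo_spec (u : (𝓞 K)ˣ) : ∃ ζ ∈ Units.torsion K,
    u = ζ * ∏ i, Units.fundSystem K i ^ expo K u i :=
  ⟨_, (Units.exist_unique_eq_mul_prod K u).choose.1.2,
    (Units.exist_unique_eq_mul_prod K u).choose_spec.1⟩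

lemma expo_eq (u ζ : (𝓞 K)ˣ) (e : Fin (Units.rank K) → ℤ) (hζ : ζ ∈ Units.torsion K)
    (h : u = ζ * ∏ i, Units.fundSystem K i ^ e i) : expo K u = e := by
  have := (Units.exist_unique_eq_mul_prod K u).unique
    (Units.exist_unique_eq_mul_prod K u).choose_spec.1 (y₂ := ⟨⟨ζ, hζ⟩, e⟩) h
  exact congrArg Prod.snd this

lemma expo_mul (a b : (𝓞 K)ˣ) : expo K (a * b) = expo K a + expo K b := by
  obtain ⟨z, hz, h1⟩ := expo_spec K a
  obtain ⟨w, hw, h2⟩ := expo_spec K b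
  apply expo_eq K _ (z * w) _ (mul_mem hz hw)
  conv_lhs => rw [h1, h2]
  simp only [Pi.add_apply, zpow_add, Finset.prod_mul_distrib]
  exact mul_mul_mul_comm _ _ _ _

lemma expo_tors (a : (𝓞 K)ˣ) (ha : a ∈ Units.torsion K) : expo K a = 0 :=
  expo_eq K _ a _ ha (by simp)

/-- exponents modulo two -/
noncomputable def expHom : (𝓞 K)ˣ →* Multiplicative (Fin (Units.rank K) → ZMod 2) where
  toFun u := Multiplicative.ofAdd fun i => ((expo K u i : ℤ) : ZMod 2)
  map_one' := by
    rw [expo_tors K 1 (one_mem _)]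
    simp; rfl
  map_mul' a b := by
    rw [expo_mul]
    simp [← ofAdd_add]; rfl

lemma tors_pm (x : (𝓞 K)ˣ) (hx : x ∈ Units.torsion K) : x = 1 ∨ x = -1 := by
  have h1 := (Units.mem_torsion K).1 hx (Classical.arbitrary (InfinitePlace K))
  set w := (Classical.arbitrary (InfinitePlace K))
  have hw : w.IsReal := IsTotallyReal.isReal w
  rw [← InfinitePlace.norm_embedding_of_isReal hw] at h1
  have h2 : rEmb K (x : K) = 1 ∨ rEmb K (x : K) = -1 := by
    rw [Real.norm_eq_abs] at h1
    exact (abs_eq zero_le_one).1 h1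
  rcases h2 with h | h
  · left
    ext
    apply (rEmb K).injective
    simpa using h
  · right
    ext
    apply (rEmb K).injective
    simpa using h

lemma sgnHom_neg_one_ne : sgnHom K (-1) ≠ 1 := by
  intro h
  have := congrArg Units.val h
  simp [sgnHom, signHom] at this

lemma sgnHom_sq (x : (𝓞 K)ˣ) : sgnHom K (x * x) = 1 := by
  rw [map_mul]
  generalize sgnHom K x = y
  revert y
  decide

lemma not_sq_neg (x : (𝓞 K)ˣ) : x * x ≠ -1 := by
  intro h
  have := sgnHom_sq K x
  rw [h] at this
  exact sgnHom_neg_one_ne K this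

lemma sq_one_pm (x : (𝓞 K)ˣ) (hx : x * x = 1) : x = 1 ∨ x = -1 := by
  have h : (x : 𝓞 K) * x = 1 := by
    have := congrArg Units.val hx
    simpa only [Units.val_mul, Units.val_one] using this
  rcases mul_self_eq_one_iff.1 h with h | h
  · left; ext; simp [h]
  · right; ext; simp [h]

lemma sq_range_eq : (sqHom (𝓞 K)ˣ).range = ((expHom K).prod (sgnHom K)).ker := by
  ext u
  rw [MonoidHom.mem_ker, MonoidHom.prod_apply, Prod.mk_eq_one]
  constructor
  · rintro ⟨x, rfl⟩
    rw [sqHom_apply]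
    refine ⟨?_, sgnHom_sq K x⟩
    rw [map_mul]
    generalize expHom K x = y
    change Multiplicative.ofAdd (Multiplicative.toAdd y + Multiplicative.toAdd y) = 1
    apply Multiplicative.toAdd.injective
    funext i
    exact CharTwo.add_self_eq_zero _
  · rintro ⟨h1, h2⟩
    have h3 : ∀ i, (2 : ℤ) ∣ expo K u i := by
      intro i
      have := congrFun (congrArg Multiplicative.toAdd h1) i
      exact (ZMod.intCast_zmod_eq_zero_iff_dvd _ 2).1 this
    choose f hf using h3
    obtain ⟨ζ, hζ, hu⟩ := expo_spec K u
    set x := ∏ i, Units.fundSystem K i ^ f i with hx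
    have hux : u = ζ * (x * x) := by
      rw [hu]
      congr 1
      rw [hx, ← Finset.prod_mul_distrib]
      refine Finset.prod_congr rfl fun i _ => ?_
      rw [hf, two_mul, zpow_add]
    have h6 : ζ = 1 := by
      rcases tors_pm K _ hζ with h | h
      · exact h
      · exfalso
        apply sgnHom_neg_one_ne K
        rw [hux, h, map_mul, sgnHom_sq, mul_one] at h2
        exact h2
    refine ⟨x, ?_⟩
    rw [sqHom_apply, hux, h6, one_mul]

lemma exp_sgn_surj : Function.Surjective ((expHom K).prod (sgnHom K)) := by
  rintro ⟨e, s⟩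
  set x := ∏ i, Units.fundSystem K i ^ ((Multiplicative.toAdd e i).val : ℤ) with hx
  have hxe : expHom K x = e := by
    apply Multiplicative.toAdd.injective
    funext i
    change ((expo K x i : ℤ) : ZMod 2) = _
    rw [expo_eq K x 1 _ (one_mem _) (by rw [one_mul])]
    simp
  have hm : expHom K (-1) = 1 := by
    apply Multiplicative.toAdd.injective
    funext i
    change ((expo K (-1) i : ℤ) : ZMod 2) = 0
    rw [expo_tors K (-1) (by
      rw [Units.mem_torsion]
      intro w
      rw [Units.val_neg, Units.val_one, map_neg, map_one, ← InfinitePlace.norm_embedding_eq]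
      simp)]
    simp
  by_cases hs : sgnHom K x = s
  · exact ⟨x, by rw [MonoidHom.prod_apply, hxe, hs]⟩
  · refine ⟨-1 * x, ?_⟩
    rw [map_mul, MonoidHom.prod_apply, MonoidHom.prod_apply, hxe, hm]
    ext1
    · simp
    · change sgnHom K (-1) * sgnHom K x = s
      have h1 := sgnHom_neg_one_ne K
      revert hs h1
      generalize sgnHom K (-1) = a
      generalize sgnHom K x = c
      revert a c s
      decide

lemma dir_index : (sqHom (𝓞 K)ˣ).range.index = 2 ^ (Module.finrank ℚ K) := by
  rw [sq_range_eq, Subgroup.index_ker, MonoidHom.range_eq_top.2 (exp_sgn_surj K),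
    Nat.card_congr (Subgroup.topEquiv.toEquiv), Nat.card_prod]
  have h1 : Nat.card SignTypeˣ = 2 := by
    rw [Nat.card_eq_fintype_card]; decide
  have h2 : Nat.card (Multiplicative (Fin (Units.rank K) → ZMod 2)) = 2 ^ (Units.rank K) := by
    rw [Nat.card_congr Multiplicative.toAdd, Nat.card_fun]; simp
  rw [h1, h2, ← pow_succ]
  congr 1
  have h3 : Fintype.card (InfinitePlace K) = Module.finrank ℚ K := by
    rw [← InfinitePlace.card_add_two_mul_card_eq_rank, InfinitePlace.card_eq_nrRealPlaces_add_nrComplexPlaces,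
     IsTotallyReal.nrComplexPlaces_eq_zero]
  rw [Units.rank, h3]
  have := Module.finrank_pos (R := ℚ) (M := K)
  omega
end Dir
end PartP4a

section PartP4b
open NumberField
open scoped Pointwise

section Herb
set_option linter.unusedSectionVars false
variable {K L : Type*} [Field K] [NumberField K] [Field L] [NumberField L] [Algebra K L]
  [IsGalois K L] (σ : Gal(L/K)) (hσ : ∀ g : Gal(L/K), g = 1 ∨ g = σ) (hσ1 : σ ≠ 1)

/-- action on units -/
noncomputable def uAct (σ : Gal(L/K)) : (𝓞 L)ˣ →* (𝓞 L)ˣ :=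
  Units.map (MulSemiringAction.toRingHom Gal(L/K) (𝓞 L) σ : 𝓞 L →* 𝓞 L)

lemma uAct_val (u : (𝓞 L)ˣ) : ((uAct σ u : (𝓞 L)ˣ) : 𝓞 L) = σ • (u : 𝓞 L) := rfl

/-- inclusion of units -/
noncomputable def uInc (K L : Type*) [Field K] [Field L] [Algebra K L] : (𝓞 K)ˣ →* (𝓞 L)ˣ :=
  Units.map (algebraMap (𝓞 K) (𝓞 L) : 𝓞 K →* 𝓞 L)

lemma uInc_val (u : (𝓞 K)ˣ) : ((uInc K L u : (𝓞 L)ˣ) : 𝓞 L) = algebraMap (𝓞 K) (𝓞 L) u := rfl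

lemma uInc_inj : Function.Injective (uInc K L) :=
  Units.map_injective (FaithfulSMul.algebraMap_injective (𝓞 K) (𝓞 L))

include hσ hσ1 in
lemma uAct_uAct (x : (𝓞 L)ˣ) : uAct σ (uAct σ x) = x := by
  ext1
  rw [uAct_val, uAct_val, smul_smul_sig σ hσ hσ1]

include hσ in
lemma uInc_range : (uInc K L).range = (dfHom (uAct σ)).ker := by
  ext u
  rw [MonoidHom.mem_ker, dfHom_apply, div_eq_one]
  constructor
  · rintro ⟨v, rfl⟩
    ext1
    rw [uAct_val, uInc_val, smul_algebraMap]
  · intro h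
    obtain ⟨a, ha⟩ := exists_of_fixed σ hσ (u : 𝓞 L) (by rw [← uAct_val, h])
    obtain ⟨b, hb⟩ := exists_of_fixed σ hσ ((u⁻¹ : (𝓞 L)ˣ) : 𝓞 L) (by
      rw [← uAct_val, map_inv, h])
    have hab : a * b = 1 := by
      apply FaithfulSMul.algebraMap_injective (𝓞 K) (𝓞 L)
      rw [map_mul, ha, hb, map_one, Units.mul_inv]
    refine ⟨⟨a, b, hab, by rw [mul_comm, hab]⟩, ?_⟩
    ext1
    exact ha

include hσ hσ1 in
lemma herb [IsTotallyReal K] [IsTotallyReal L]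
    (hdeg : Module.finrank ℚ L = 2 * Module.finrank ℚ K) :
    2 * (nmHom (uAct σ)).range.relIndex (dfHom (uAct σ)).ker =
      (dfHom (uAct σ)).range.relIndex (nmHom (uAct σ)).ker := by
  refine herbrand_aux (uAct σ) (uAct_uAct σ hσ hσ1) (-1) (by simp) (not_sq_neg L) (sq_one_pm L)
    ?_ ?_
  · rw [dir_index]; positivity
  · rw [dir_index, ← uInc_range σ hσ, hdeg, mul_comm, pow_mul]
    congr 1
    rw [← dir_index K]
    have h1 : (uInc K L).range.map (sqHom (𝓞 L)ˣ) = (sqHom (𝓞 K)ˣ).range.map (uInc K L) := by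
      rw [MonoidHom.range_eq_map, MonoidHom.range_eq_map, Subgroup.map_map, Subgroup.map_map]
      congr 1
      ext1 x
      simp [sqHom_apply]
    rw [h1, MonoidHom.range_eq_map (uInc K L), Subgroup.relIndex_map_map_of_injective _ _ uInc_inj,
      Subgroup.relIndex_top_right]

/-- clearing denominators -/
lemma int_den {L : Type*} [Field L] [NumberField L] (y : L) :
    ∃ m : ℤ, m ≠ 0 ∧ ∃ a : 𝓞 L, algebraMap (𝓞 L) L a = m * y := by
  have h : IsAlgebraic ℤ y :=
    (IsFractionRing.isAlgebraic_iff ℤ ℚ L).2 (Algebra.IsAlgebraic.isAlgebraic y)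
  obtain ⟨m, hm0, hm⟩ := h.exists_integral_multiple
  refine ⟨m, hm0, ⟨m • y, hm⟩, ?_⟩
  rw [← zsmul_eq_mul]
  rfl

/-- Elementary Hilbert 90 for quadratic extensions. -/
lemma h90 (hss : ∀ x : L, σ (σ x) = x) (hσ1 : σ ≠ 1) (α : L) (hα : α * σ α = 1) :
    ∃ γ : 𝓞 L, γ ≠ 0 ∧ α * (algebraMap (𝓞 L) L γ) = algebraMap (𝓞 L) L (σ • γ) := by
  obtain ⟨y, hy0, hy⟩ : ∃ y : L, y ≠ 0 ∧ α * y = σ y := by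
    by_cases h : α = -1
    · obtain ⟨x, hx⟩ : ∃ x, σ x ≠ x := by
        by_contra! hc
        exact hσ1 (AlgEquiv.ext hc)
      refine ⟨x - σ x, sub_ne_zero.2 hx.symm, ?_⟩
      rw [h, map_sub, hss]; ring
    · refine ⟨1 + σ α, ?_, ?_⟩
      · intro h0
        apply h
        have h1 : σ α = -1 := by linear_combination h0
        have h2 : σ (σ α) = -1 := by rw [h1]; simp
        rwa [hss] at h2
      · rw [map_add, hss, map_one]; linear_combination hα
  obtain ⟨m, hm0, a, ha⟩ := int_den y
  refine ⟨a, ?_, ?_⟩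
  · rintro rfl
    rw [map_zero] at ha
    exact mul_ne_zero (Int.cast_ne_zero.2 hm0) hy0 ha.symm
  · have : algebraMap (𝓞 L) L (σ • a) = σ (algebraMap (𝓞 L) L a) := rfl
    rw [this, ha, map_mul, map_intCast, ← hy]; ring

end Herb
end PartP4b

section PartP4c
open NumberField
open scoped Pointwise nonZeroDivisors

section Main
set_option linter.unusedSectionVars false
variable {K L : Type*} [Field K] [NumberField K] [Field L] [NumberField L] [Algebra K L]
  [IsGalois K L] (σ : Gal(L/K)) (hσ : ∀ g : Gal(L/K), g = 1 ∨ g = σ) (hσ1 : σ ≠ 1)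

lemma smul_span (x : 𝓞 L) : σ • (Ideal.span {x}) = Ideal.span {σ • x} := by
  rw [Ideal.pointwise_smul_def, Ideal.map_span, Set.image_singleton]
  rfl

lemma par_alg (a : 𝓞 K) (ha : a ≠ 0) (p : Ideal (𝓞 K)) :
    par (Ideal.span {algebraMap (𝓞 K) (𝓞 L) a}) p = 0 := by
  rw [← par_ext (L := L) (Ideal.span {a}) p (by simpa using ha), extI, Ideal.map_span,
    Set.image_singleton]

include hσ hσ1 in
lemma par_wd (η γ γ' : 𝓞 L) (h0 : γ ≠ 0) (h0' : γ' ≠ 0) (h : σ • γ = η * γ) (h' : σ • γ' = η * γ')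
    (p : Ideal (𝓞 K)) : par (Ideal.span {γ}) p = par (Ideal.span {γ'}) p := by
  have hs0 : ∀ x : 𝓞 L, x ≠ 0 → σ • x ≠ 0 := fun x hx => (smul_ne_zero_iff_ne σ).2 hx
  obtain ⟨a, ha⟩ := exists_of_fixed σ hσ (γ * σ • γ') (by
    rw [smul_mul', smul_smul_sig σ hσ hσ1, h, h']; ring)
  obtain ⟨b, hb⟩ := exists_of_fixed σ hσ (γ' * σ • γ') (by
    rw [smul_mul', smul_smul_sig σ hσ hσ1]; ring)
  have ha0 : a ≠ 0 := by
    rintro rfl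
    rw [map_zero] at ha
    exact mul_ne_zero h0 (hs0 _ h0') ha.symm
  have hb0 : b ≠ 0 := by
    rintro rfl
    rw [map_zero] at hb
    exact mul_ne_zero h0' (hs0 _ h0') hb.symm
  have hinj := FaithfulSMul.algebraMap_injective (𝓞 K) (𝓞 L)
  have e : Ideal.span {γ} * Ideal.span {algebraMap (𝓞 K) (𝓞 L) b} =
      Ideal.span {γ'} * Ideal.span {algebraMap (𝓞 K) (𝓞 L) a} := by
    rw [Ideal.span_singleton_mul_span_singleton, Ideal.span_singleton_mul_span_singleton, ha, hb]
    congr 2; ring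
  have e2 := congrArg (fun I => par I p) e
  rwa [par_mul (by simpa using h0) (by simpa using hb0),
    par_mul (by simpa using h0') (by simpa using ha0), par_alg a ha0, par_alg b hb0, add_zero,
    add_zero] at e2

include hσ hσ1 in
lemma V_h90 (η : (nmHom (uAct σ)).ker) :
    ∃ γ : 𝓞 L, γ ≠ 0 ∧ σ • γ = ((η : (𝓞 L)ˣ) : 𝓞 L) * γ := by
  have hη := η.2
  rw [MonoidHom.mem_ker, nmHom_apply] at hη
  obtain ⟨γ, h0, h⟩ := h90 σ (fun x => smul_smul_sig σ hσ hσ1 x) hσ1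
    (algebraMap (𝓞 L) L ((η : (𝓞 L)ˣ) : 𝓞 L)) (by
      have := congrArg (fun u : (𝓞 L)ˣ => algebraMap (𝓞 L) L (u : 𝓞 L)) hη
      simp only [Units.val_mul, map_mul, Units.val_one, map_one] at this
      exact this)
  refine ⟨γ, h0, ?_⟩
  apply FaithfulSMul.algebraMap_injective (𝓞 L) L
  rw [← h, map_mul]

/-- chosen Hilbert 90 witness -/
noncomputable def gam (η : (nmHom (uAct σ)).ker) : 𝓞 L := (V_h90 σ hσ hσ1 η).choose

lemma gam_ne (η : (nmHom (uAct σ)).ker) : gam σ hσ hσ1 η ≠ 0 := (V_h90 σ hσ hσ1 η).choose_spec.1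

lemma gam_spec (η : (nmHom (uAct σ)).ker) :
    σ • gam σ hσ hσ1 η = ((η : (𝓞 L)ˣ) : 𝓞 L) * gam σ hσ hσ1 η :=
  (V_h90 σ hσ hσ1 η).choose_spec.2

lemma gam_stable (η : (nmHom (uAct σ)).ker) :
    σ • (Ideal.span {gam σ hσ hσ1 η}) = Ideal.span {gam σ hσ hσ1 η} := by
  rw [smul_span, gam_spec]
  exact Ideal.span_singleton_mul_left_unit (Units.isUnit _) _

/-- parity homomorphism -/
noncomputable def fHom (T : Finset (Ideal (𝓞 K))) :
    (nmHom (uAct σ)).ker →* Multiplicative (T → ZMod 2) :=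
  MonoidHom.mk' (fun η => Multiplicative.ofAdd fun t => par (Ideal.span {gam σ hσ hσ1 η}) t.1) (by
    intro a b
    rw [← ofAdd_add]
    congr 1
    funext t
    rw [Pi.add_apply, ← par_mul (by simpa using gam_ne σ hσ hσ1 a)
      (by simpa using gam_ne σ hσ hσ1 b), Ideal.span_singleton_mul_span_singleton]
    refine par_wd σ hσ hσ1 _ _ _ (gam_ne σ hσ hσ1 _)
      (mul_ne_zero (gam_ne σ hσ hσ1 a) (gam_ne σ hσ hσ1 b)) (gam_spec σ hσ hσ1 _) ?_ _
    rw [smul_mul', gam_spec, gam_spec, Subgroup.coe_mul, Units.val_mul]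
    ring)

lemma ext_pow_principal (J : Ideal (𝓞 K)) (hJ : J ≠ ⊥) :
    ∃ j : 𝓞 K, j ≠ 0 ∧ (extI L J) ^ (Nat.card (ClassGroup (𝓞 K))) =
      Ideal.span {algebraMap (𝓞 K) (𝓞 L) j} := by
  set h := Nat.card (ClassGroup (𝓞 K))
  have hJh : J ^ h ≠ ⊥ := pow_ne_zero h hJ
  have h1 : ClassGroup.mk0 (⟨J ^ h, mem_nonZeroDivisors_of_ne_zero hJh⟩ : (Ideal (𝓞 K))⁰) = 1 := by
    have : (⟨J ^ h, mem_nonZeroDivisors_of_ne_zero hJh⟩ : (Ideal (𝓞 K))⁰) =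
      (⟨J, mem_nonZeroDivisors_of_ne_zero hJ⟩ : (Ideal (𝓞 K))⁰) ^ h := rfl
    rw [this, map_pow]
    exact pow_card_eq_one'
  rw [ClassGroup.mk0_eq_one_iff] at h1
  obtain ⟨j, hj⟩ := h1.principal
  have hj' : J ^ h = Ideal.span {j} := hj
  refine ⟨j, ?_, ?_⟩
  · rintro rfl
    exact hJh (by rw [hj']; simp)
  · rw [extI, ← Ideal.map_pow, hj', Ideal.map_span, Set.image_singleton]

include hσ hσ1 in
lemma ker_f_le (T : Finset (Ideal (𝓞 K)))
    (hT : ∀ P : Ideal (𝓞 L), P.IsPrime → P ≠ ⊥ → P.under (𝓞 K) ∉ T → ∃ x : 𝓞 L, σ • x - x ∉ P)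
    (hodd : Odd (Nat.card (ClassGroup (𝓞 K)))) :
    (fHom σ hσ hσ1 T).ker ≤ (dfHom (uAct σ)).range.subgroupOf (nmHom (uAct σ)).ker := by
  intro η hη
  rw [Subgroup.mem_subgroupOf]
  rw [MonoidHom.mem_ker] at hη
  obtain ⟨J, hJ0, hJ⟩ := desc σ hσ hσ1 T hT _ (Ideal.span {gam σ hσ hσ1 η})
    (by simpa using gam_ne σ hσ hσ1 η) rfl (gam_stable σ hσ hσ1 η) (by
      intro p hp
      exact congrFun (congrArg Multiplicative.toAdd hη) ⟨p, hp⟩)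
  obtain ⟨j, hj0, hj⟩ := ext_pow_principal (L := L) J hJ0
  obtain ⟨k, hk⟩ := hodd
  set h := Nat.card (ClassGroup (𝓞 K))
  rw [hJ, Ideal.span_singleton_pow, Ideal.span_singleton_eq_span_singleton] at hj
  obtain ⟨ε, hε⟩ := hj
  have hg := gam_spec σ hσ hσ1 η
  have hg0 := gam_ne σ hσ hσ1 η
  set γ := gam σ hσ hσ1 η
  have hsj : (σ • γ) ^ h * σ • (ε : 𝓞 L) = algebraMap (𝓞 K) (𝓞 L) j := by
    rw [← smul_pow', ← smul_mul', hε, smul_algebraMap]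
  have h1 : (η : (𝓞 L)ˣ) ^ h = dfHom (uAct σ) ε⁻¹ := by
    rw [dfHom_apply, map_inv, div_inv_eq_mul, inv_mul_eq_div, eq_div_iff_mul_eq']
    ext1
    rw [Units.val_mul, Units.val_pow_eq_pow_val, uAct_val]
    apply mul_left_cancel₀ (pow_ne_zero h hg0)
    rw [hε, ← hsj, hg]
    ring
  have h2 : (η : (𝓞 L)ˣ) ^ 2 = dfHom (uAct σ) (η : (𝓞 L)ˣ)⁻¹ := by
    have hη2 := η.2
    rw [MonoidHom.mem_ker, nmHom_apply] at hη2
    rw [dfHom_apply, map_inv, div_inv_eq_mul, pow_two]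
    congr 1
    exact eq_inv_of_mul_eq_one_left hη2
  have h3 : (η : (𝓞 L)ˣ) = (η : (𝓞 L)ˣ) ^ h * (((η : (𝓞 L)ˣ) ^ 2) ^ k)⁻¹ := by
    rw [hk, pow_succ, pow_mul]; group
  rw [h3, h1, h2]
  exact mul_mem ⟨_, rfl⟩ (inv_mem (pow_mem (MonoidHom.mem_range.2 ⟨_, rfl⟩) _))

variable (T : Finset (Ideal (𝓞 K)))
    (hT : ∀ P : Ideal (𝓞 L), P.IsPrime → P ≠ ⊥ → P.under (𝓞 K) ∉ T → ∃ x : 𝓞 L, σ • x - x ∉ P)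
    (hodd : Odd (Nat.card (ClassGroup (𝓞 K))))
    (hdeg : Module.finrank ℚ L = 2 * Module.finrank ℚ K)
    (s : Finset (𝓞 K)ˣ) (hs : ∀ u ∈ s, ∀ v ∈ s, u ≠ v → ∀ η : (𝓞 L)ˣ,
      uInc K L u ≠ uInc K L v * (η * uAct σ η))
    (hcard : 2 ^ T.card ≤ 2 * s.card)

include hT hodd hdeg hs hcard in
lemma counting [IsTotallyReal K] [IsTotallyReal L] :
    (fHom σ hσ hσ1 T).range = ⊤ ∧
    ∀ u : (𝓞 K)ˣ, ∃ v ∈ s, ∃ η : (𝓞 L)ˣ, uInc K L u = uInc K L v * (η * uAct σ η) := by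
  have hcod : Nat.card (Multiplicative (T → ZMod 2)) = 2 ^ T.card := by
    rw [Nat.card_congr Multiplicative.toAdd, Nat.card_fun]; simp
  have hfr : Nat.card (fHom σ hσ hσ1 T).range ≤ 2 ^ T.card := by
    rw [← hcod]; exact Subgroup.card_le_card_group _
  have hle := Subgroup.index_dvd_of_le (ker_f_le σ hσ hσ1 T hT hodd)
  rw [Subgroup.index_ker] at hle
  have hpos : 0 < Nat.card (fHom σ hσ hσ1 T).range := Nat.card_pos
  have hle2 := Nat.le_of_dvd hpos hle
  have hV0 : 0 < (dfHom (uAct σ)).range.relIndex (nmHom (uAct σ)).ker := Nat.pos_of_dvd_of_pos hle hpos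
  have hherb := herb σ hσ hσ1 hdeg
  change (dfHom (uAct σ)).range.relIndex (nmHom (uAct σ)).ker ≤ _ at hle2
  let q : s → ↥(dfHom (uAct σ)).ker ⧸ ((nmHom (uAct σ)).range.subgroupOf ((dfHom (uAct σ)).ker)) := fun u => QuotientGroup.mk
    ⟨uInc K L u.1, by rw [← uInc_range σ hσ]; exact ⟨_, rfl⟩⟩
  have hq : Function.Injective q := by
    intro u v huv
    by_contra hne
    have h1 := QuotientGroup.eq.1 huv.symm
    rw [Subgroup.mem_subgroupOf] at h1
    obtain ⟨η, hη⟩ := h1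
    apply hs u.1 u.2 v.1 v.2 (fun h => hne (Subtype.ext h)) η
    rw [← nmHom_apply, hη]
    simp
  have hn0 : ((nmHom (uAct σ)).range.subgroupOf ((dfHom (uAct σ)).ker)).index ≠ 0 := by
    intro h0
    have : (nmHom (uAct σ)).range.relIndex (dfHom (uAct σ)).ker = 0 := h0
    omega
  have : Finite (↥(dfHom (uAct σ)).ker ⧸ ((nmHom (uAct σ)).range.subgroupOf ((dfHom (uAct σ)).ker))) := Nat.finite_of_card_ne_zero hn0
  have hsle : s.card ≤ (nmHom (uAct σ)).range.relIndex (dfHom (uAct σ)).ker := by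
    have := Nat.card_le_card_of_injective q hq
    rw [Nat.card_eq_fintype_card, Fintype.card_coe] at this
    exact this
  have hEq : Nat.card (fHom σ hσ hσ1 T).range = 2 ^ T.card := by omega
  have hseq : s.card = (nmHom (uAct σ)).range.relIndex (dfHom (uAct σ)).ker := by omega
  refine ⟨Subgroup.eq_top_of_card_eq _ (by rw [hEq, hcod]), ?_⟩
  intro u
  have hbij : Function.Bijective q := by
    refine (Nat.bijective_iff_injective_and_card q).2 ⟨hq, ?_⟩
    rw [Nat.card_eq_fintype_card, Fintype.card_coe, hseq]
    rfl
  obtain ⟨v, hv⟩ := hbij.2 (QuotientGroup.mk ⟨uInc K L u, by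
    rw [← uInc_range σ hσ]; exact ⟨_, rfl⟩⟩)
  have h1 := QuotientGroup.eq.1 hv
  rw [Subgroup.mem_subgroupOf] at h1
  obtain ⟨η, hη⟩ := h1
  refine ⟨v.1, v.2, η, ?_⟩
  rw [← nmHom_apply, hη]
  simp

include hT hσ1 in
lemma stable_odd (hsurj : (fHom σ hσ hσ1 T).range = ⊤) (I : Ideal (𝓞 L)) (hI : I ≠ ⊥)
    (hst : σ • I = I) :
    ∃ γ : 𝓞 L, γ ≠ 0 ∧ ∃ j : 𝓞 L, j ≠ 0 ∧
      (I * Ideal.span {γ}) ^ Nat.card (ClassGroup (𝓞 K)) = Ideal.span {j} := by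
  obtain ⟨η, hη⟩ := MonoidHom.range_eq_top.1 hsurj (Multiplicative.ofAdd fun t => par I t.1)
  have hg0 : Ideal.span {gam σ hσ hσ1 η} ≠ ⊥ := by simpa using gam_ne σ hσ hσ1 η
  obtain ⟨J, hJ0, hJ⟩ := desc σ hσ hσ1 T hT _ (I * Ideal.span {gam σ hσ hσ1 η})
    (mul_ne_zero hI hg0) rfl (by
      rw [smul_mul', hst, gam_stable]) (by
      intro p hp
      rw [par_mul hI hg0]
      have := congrFun (congrArg Multiplicative.toAdd hη) ⟨p, hp⟩
      have h2 : par (Ideal.span {gam σ hσ hσ1 η}) p = par I p := this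
      rw [h2]
      exact CharTwo.add_self_eq_zero _)
  obtain ⟨j, hj0, hj⟩ := ext_pow_principal (L := L) J hJ0
  refine ⟨_, gam_ne σ hσ hσ1 η, algebraMap (𝓞 K) (𝓞 L) j, ?_, ?_⟩
  · intro h
    exact hj0 (FaithfulSMul.algebraMap_injective (𝓞 K) (𝓞 L) (by rw [h, map_zero]))
  · rw [← hj, hJ]

/-- class of a nonzero ideal -/
noncomputable def cls {R : Type*} [CommRing R] [IsDedekindDomain R] (I : Ideal R) (hI : I ≠ ⊥) :
    ClassGroup R := ClassGroup.mk0 ⟨I, mem_nonZeroDivisors_of_ne_zero hI⟩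

lemma cls_mul {R : Type*} [CommRing R] [IsDedekindDomain R] (I J : Ideal R) (hI : I ≠ ⊥)
    (hJ : J ≠ ⊥) : cls (I * J) (mul_ne_zero hI hJ) = cls I hI * cls J hJ := by
  rw [cls, cls, cls, ← map_mul]; rfl

lemma cls_pow {R : Type*} [CommRing R] [IsDedekindDomain R] (I : Ideal R) (hI : I ≠ ⊥) (n : ℕ) :
    cls (I ^ n) (pow_ne_zero n hI) = cls I hI ^ n := by
  rw [cls, cls, ← map_pow]; rfl

lemma cls_one_iff {R : Type*} [CommRing R] [IsDedekindDomain R] (I : Ideal R) (hI : I ≠ ⊥) :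
    cls I hI = 1 ↔ ∃ j, j ≠ 0 ∧ I = Ideal.span {j} := by
  rw [cls, ClassGroup.mk0_eq_one_iff]
  constructor
  · intro h
    obtain ⟨j, hj⟩ := h.principal
    have hj' : I = Ideal.span {j} := hj
    refine ⟨j, ?_, hj'⟩
    rintro rfl
    exact hI (by rw [hj']; simp)
  · rintro ⟨j, -, hj⟩
    exact ⟨⟨j, hj⟩⟩

include hT hσ1 in
lemma stable_cls (hsurj : (fHom σ hσ hσ1 T).range = ⊤) (I : Ideal (𝓞 L)) (hI : I ≠ ⊥)
    (hst : σ • I = I) : cls I hI ^ Nat.card (ClassGroup (𝓞 K)) = 1 := by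
  obtain ⟨γ, hγ, j, hj0, hj⟩ := stable_odd σ hσ hσ1 T hT hsurj I hI hst
  have hg0 : Ideal.span {γ} ≠ ⊥ := by simpa using hγ
  have h1 := (cls_one_iff _ (pow_ne_zero _ (mul_ne_zero hI hg0))).2 ⟨j, hj0, hj⟩
  rw [cls_pow _ (mul_ne_zero hI hg0), cls_mul _ _ hI hg0, (cls_one_iff _ hg0).2 ⟨γ, hγ, rfl⟩,
    mul_one] at h1
  exact h1

lemma odd_two {G : Type*} [Group G] (x : G) (n : ℕ) (hn : Odd n) (h1 : x ^ n = 1)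
    (h2 : x ^ 2 = 1) : x = 1 := by
  obtain ⟨k, rfl⟩ := hn
  rwa [pow_succ, pow_mul, h2, one_pow, one_mul] at h1

include hσ hσ1 hT hodd hdeg hcard in
/-- Main class number theorem. -/
theorem main_odd [IsTotallyReal K] [IsTotallyReal L] (h1s : (1 : (𝓞 K)ˣ) ∈ s)
    (H : ∀ u ∈ s, ∀ v ∈ s, u ≠ v → ∀ x : L, algebraMap K L (algebraMap (𝓞 K) K u) ≠
      algebraMap K L (algebraMap (𝓞 K) K v) * (x * σ x)) :
    Odd (Nat.card (ClassGroup (𝓞 L))) ∧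
    ∀ u : (𝓞 K)ˣ, ∃ v ∈ s, ∃ η : (𝓞 L)ˣ, uInc K L u = uInc K L v * (η * uAct σ η) := by
  have hs : ∀ u ∈ s, ∀ v ∈ s, u ≠ v → ∀ η : (𝓞 L)ˣ,
      uInc K L u ≠ uInc K L v * (η * uAct σ η) := by
    intro u hu v hv huv η hη
    apply H u hu v hv huv (algebraMap (𝓞 L) L η)
    have := congrArg (fun u : (𝓞 L)ˣ => algebraMap (𝓞 L) L (u : 𝓞 L)) hη
    simp only [Units.val_mul, map_mul] at this
    exact this
  have hs' : ∀ v ∈ s, v ≠ 1 → ∀ x : L, x * σ x ≠ algebraMap K L (algebraMap (𝓞 K) K v) := by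
    intro v hv hv1 x hx
    apply H v hv 1 h1s hv1 x
    rw [hx]; simp
  obtain ⟨hsurj, hall⟩ := counting σ hσ hσ1 T hT hodd hdeg s hs hcard
  refine ⟨?_, hall⟩
  have key : ∀ c : ClassGroup (𝓞 L), c ^ 2 = 1 → c = 1 := by
    intro c hc
    obtain ⟨⟨I, hI'⟩, rfl⟩ := ClassGroup.mk0_surjective c
    have hI : I ≠ ⊥ := nonZeroDivisors.ne_zero hI'
    change cls I hI ^ 2 = 1 at hc
    change cls I hI = 1
    have hsI : σ • I ≠ ⊥ := smul_ne_bot σ hI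
    have hc0 := hc
    rw [← cls_pow, cls_one_iff] at hc
    obtain ⟨δ, hδ0, hδ⟩ := hc
    have hss : ∀ x : 𝓞 L, σ • σ • x = x := smul_smul_sig σ hσ hσ1
    have hs0 : ∀ x : 𝓞 L, x ≠ 0 → σ • x ≠ 0 := fun x hx => (smul_ne_zero_iff_ne σ).2 hx
    have hJst : σ • (I * σ • I) = I * σ • I := by
      rw [smul_mul', smul_smul_sig σ hσ hσ1, mul_comm]
    have hsδ : (σ • I) ^ 2 = Ideal.span {σ • δ} := by
      rw [← smul_pow', hδ, smul_span]
    have hJ1 : cls (I * σ • I) (mul_ne_zero hI hsI) = 1 := by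
      apply odd_two _ _ hodd (stable_cls σ hσ hσ1 T hT hsurj _ _ hJst)
      rw [cls_mul _ _ hI hsI, mul_pow, hc0, one_mul, ← cls_pow, cls_one_iff]
      exact ⟨_, hs0 _ hδ0, hsδ⟩
    obtain ⟨β, hβ0, hβ⟩ := (cls_one_iff _ _).1 hJ1
    have hβst : Ideal.span {σ • β} = Ideal.span {β} := by
      rw [← smul_span, ← hβ, hJst]
    have hNN : Ideal.span {δ * σ • δ} = Ideal.span {β * σ • β} := by
      rw [← Ideal.span_singleton_mul_span_singleton, ← Ideal.span_singleton_mul_span_singleton,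
        hβst, ← hδ, ← hsδ, ← hβ]
      ring
    rw [Ideal.span_singleton_eq_span_singleton] at hNN
    obtain ⟨u, hu⟩ := hNN
    have hNδ0 : δ * σ • δ ≠ 0 := mul_ne_zero hδ0 (hs0 _ hδ0)
    have hufix : u ∈ (uInc K L).range := by
      rw [uInc_range σ hσ, MonoidHom.mem_ker, dfHom_apply, div_eq_one]
      ext1
      rw [uAct_val]
      apply mul_left_cancel₀ hNδ0
      rw [hu]
      have := congrArg (σ • ·) hu
      simp only [smul_mul', hss] at this
      rw [mul_comm δ, this]; ring
    obtain ⟨w, rfl⟩ := hufix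
    obtain ⟨v, hv, η, hη⟩ := hall w
    have hv1 : v = 1 := by
      by_contra hne
      have hL : algebraMap (𝓞 L) L δ ≠ 0 := by simpa using hδ0
      have hL' : algebraMap (𝓞 L) L (σ • δ) ≠ 0 := by simpa using hs0 _ hδ0
      have hηu : algebraMap (𝓞 L) L (η : 𝓞 L) ≠ 0 := by simp
      have hηu' : algebraMap (𝓞 L) L (σ • (η : 𝓞 L)) ≠ 0 := by
        simpa using hs0 _ η.ne_zero
      apply hs' v hv hne (algebraMap (𝓞 L) L β / (algebraMap (𝓞 L) L δ * algebraMap (𝓞 L) L η))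
      have e1 : ∀ x : 𝓞 L, σ (algebraMap (𝓞 L) L x) = algebraMap (𝓞 L) L (σ • x) := fun _ => rfl
      have e2 : algebraMap K L (algebraMap (𝓞 K) K v) =
        algebraMap (𝓞 L) L ((uInc K L v : (𝓞 L)ˣ) : 𝓞 L) := rfl
      rw [map_div₀, map_mul, e1, e1, e1, e2, div_mul_div_comm, div_eq_iff (by positivity)]
      have h5 := congrArg (algebraMap (𝓞 L) L) hu
      rw [hη] at h5
      simp only [Units.val_mul, map_mul, uAct_val] at h5
      rw [← h5]; ring
    rw [hv1, map_one, one_mul] at hη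
    rw [hη] at hu
    have huv : δ * σ • δ * ((η : 𝓞 L) * σ • (η : 𝓞 L)) = β * σ • β := by
      rw [← hu]; rfl
    have hLβ : algebraMap (𝓞 L) L β ≠ 0 := by simpa using hβ0
    have hLβ' : algebraMap (𝓞 L) L (σ • β) ≠ 0 := by simpa using hs0 _ hβ0
    obtain ⟨γ, hγ0, hγ⟩ := h90 σ (fun x => smul_smul_sig σ hσ hσ1 x) hσ1
      (algebraMap (𝓞 L) L (δ * η) / algebraMap (𝓞 L) L β) (by
        have e1 : ∀ x : 𝓞 L, σ (algebraMap (𝓞 L) L x) = algebraMap (𝓞 L) L (σ • x) := fun _ => rfl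
        rw [map_div₀, e1, e1, div_mul_div_comm, div_eq_one_iff_eq (mul_ne_zero hLβ hLβ'),
          ← map_mul, ← map_mul, ← huv, smul_mul']
        congr 1; ring)
    rw [div_mul_eq_mul_div, div_eq_iff hLβ, ← map_mul, ← map_mul] at hγ
    have hγ' := FaithfulSMul.algebraMap_injective (𝓞 L) L hγ
    have hg0 : Ideal.span {γ} ≠ ⊥ := by simpa using hγ0
    have hst : σ • (Ideal.span {γ} * I) = Ideal.span {γ} * I := by
      have hd0 : Ideal.span {δ} ≠ ⊥ := by simpa using hδ0
      apply mul_left_cancel₀ hd0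
      have h1 : Ideal.span {δ} * σ • I = Ideal.span {β} * I := by
        rw [← hδ, ← hβ]; ring
      have h2 : Ideal.span {σ • γ} * Ideal.span {β} = Ideal.span {δ} * Ideal.span {γ} := by
        rw [Ideal.span_singleton_mul_span_singleton, ← hγ', Ideal.span_singleton_mul_span_singleton,
          mul_right_comm]
        exact Ideal.span_singleton_mul_right_unit (Units.isUnit η) _
      rw [smul_mul', smul_span, mul_left_comm, h1, ← mul_assoc, h2, mul_assoc]
    have h6 := stable_cls σ hσ hσ1 T hT hsurj _ (mul_ne_zero hg0 hI) hst
    rw [cls_mul _ _ hg0 hI, (cls_one_iff _ hg0).2 ⟨γ, hγ0, rfl⟩, one_mul] at h6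
    exact odd_two _ _ hodd h6 hc0
  by_contra hnot
  rw [Nat.not_odd_iff_even] at hnot
  obtain ⟨c, hc⟩ := exists_prime_orderOf_dvd_card' 2 hnot.two_dvd
  have h1 := key c (by rw [← hc]; exact pow_orderOf_eq_one c)
  rw [h1, orderOf_one] at hc
  omega

end Main
end PartP4c

section PartP5a
open NumberField
open scoped Pointwise nonZeroDivisors

section Setup
set_option linter.unusedSectionVars false
variable {K L : Type*} [Field K] [NumberField K] [Field L] [NumberField L] [Algebra K L]

/-- `L = K(x)` with `x ^ 2 = m`. -/
structure QuadExt (K L : Type*) [Field K] [Field L] [Algebra K L] (x : L) (m : K) : Prop where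
  sq : x ^ 2 = algebraMap K L m
  nmem : ∀ a : K, algebraMap K L a ≠ x
  gen : ∀ y : L, ∃ a b : K, y = algebraMap K L a + algebraMap K L b * x

lemma QuadExt.uniq {x : L} {m : K} (h : QuadExt K L x m) {a b a' b' : K}
    (e : algebraMap K L a + algebraMap K L b * x = algebraMap K L a' + algebraMap K L b' * x) :
    a = a' ∧ b = b' := by
  have hb : b = b' := by
    by_contra hne
    apply h.nmem ((a' - a) / (b - b'))
    have h0 : algebraMap K L (b - b') ≠ 0 := by
      exact (map_ne_zero _).2 (sub_ne_zero.2 hne)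
    rw [map_div₀, div_eq_iff h0, map_sub, map_sub]
    linear_combination (-1 : L) * e
  refine ⟨?_, hb⟩
  apply (algebraMap K L).injective
  rw [hb] at e
  exact add_right_cancel e

lemma QuadExt.quad {x : L} {m : K} (h : QuadExt K L x m) : Algebra.IsQuadraticExtension K L := by
  let f : (Fin 2 → K) →ₗ[K] L :=
    { toFun := fun v => algebraMap K L (v 0) + algebraMap K L (v 1) * x
      map_add' := by intro v w; simp only [Pi.add_apply, map_add]; ring
      map_smul' := by
        intro c v
        simp only [Pi.smul_apply, smul_eq_mul, map_mul, RingHom.id_apply, Algebra.smul_def]; ring }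
  have hf : Function.Bijective f := by
    constructor
    · intro v w hvw
      obtain ⟨h1, h2⟩ := h.uniq hvw
      funext i
      fin_cases i
      · exact h1
      · exact h2
    · intro y
      obtain ⟨a, b, rfl⟩ := h.gen y
      exact ⟨![a, b], by simp [f]⟩
  refine ⟨?_⟩
  rw [← (LinearEquiv.ofBijective f hf).finrank_eq]
  simp

lemma QuadExt.setup {x : L} {m : K} (h : QuadExt K L x m) :
    IsGalois K L ∧ Module.finrank ℚ L = 2 * Module.finrank ℚ K ∧
    ∃ σ : Gal(L/K), (∀ g : Gal(L/K), g = 1 ∨ g = σ) ∧ σ ≠ 1 ∧ σ x = -x := by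
  have hq := h.quad
  have hG : IsGalois K L := inferInstance
  refine ⟨hG, ?_, ?_⟩
  · rw [← Module.finrank_mul_finrank ℚ K L, hq.finrank_eq_two, mul_comm]
  · have hc : Nat.card Gal(L/K) = 2 := by
      rw [IsGalois.card_aut_eq_finrank, hq.finrank_eq_two]
    obtain ⟨a, b, hab, hU⟩ := Nat.card_eq_two_iff.1 hc
    have hex : ∃ σ : Gal(L/K), (∀ g : Gal(L/K), g = 1 ∨ g = σ) ∧ σ ≠ 1 := by
      have hmem : ∀ g : Gal(L/K), g = a ∨ g = b := by
        intro g
        have : g ∈ ({a, b} : Set Gal(L/K)) := by rw [hU]; trivial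
        simpa using this
      rcases hmem 1 with h1 | h1
      · exact ⟨b, by rw [h1]; exact hmem, by rw [h1]; exact hab.symm⟩
      · exact ⟨a, by rw [h1]; exact fun g => (hmem g).symm, by rw [h1]; exact hab⟩
    obtain ⟨σ, h1, h2⟩ := hex
    refine ⟨σ, h1, h2, ?_⟩
    have h3 : (σ x) ^ 2 = x ^ 2 := by rw [← map_pow, h.sq, AlgEquiv.commutes]
    rcases sq_eq_sq_iff_eq_or_eq_neg.1 h3 with h4 | h4
    · exfalso
      apply h2
      ext y
      obtain ⟨a, b, rfl⟩ := h.gen y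
      simp [h4]
    · exact h4

lemma QuadExt.totReal [IsTotallyReal K] {x : L} {m : K} (h : QuadExt K L x m)
    (hm : ∀ φ : K →+* ℂ, ∃ r : ℝ, 0 ≤ r ∧ φ m = r) : IsTotallyReal L := by
  refine ⟨fun w => ?_⟩
  rw [InfinitePlace.isReal_iff, ComplexEmbedding.isReal_iff]
  set φ := w.embedding
  ext y
  obtain ⟨a, b, rfl⟩ := h.gen y
  have hK := IsTotallyReal.complexEmbedding_isReal (φ.comp (algebraMap K L))
  rw [ComplexEmbedding.isReal_iff] at hK
  have hKa : ∀ a : K, (starRingEnd ℂ) (φ (algebraMap K L a)) = φ (algebraMap K L a) := fun a =>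
    RingHom.congr_fun hK a
  have hx : (starRingEnd ℂ) (φ x) = φ x := by
    obtain ⟨r, hr, hr2⟩ := hm (φ.comp (algebraMap K L))
    have h1 : φ x ^ 2 = ((Real.sqrt r : ℝ) : ℂ) ^ 2 := by
      rw [← map_pow, h.sq, ← Complex.ofReal_pow, Real.sq_sqrt hr, ← hr2]; rfl
    rcases sq_eq_sq_iff_eq_or_eq_neg.1 h1 with h2 | h2
    · rw [h2, Complex.conj_ofReal]
    · rw [h2, map_neg, Complex.conj_ofReal]
  change (starRingEnd ℂ) (φ _) = φ _
  rw [map_add, map_mul, map_add, map_mul, hKa, hKa, hx]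

lemma QuadExt.sqs {x : L} {m : K} (h : QuadExt K L x m) {y : K}
    (hy : IsSquare (algebraMap K L y)) : IsSquare y ∨ IsSquare (y * m) := by
  obtain ⟨z, hz⟩ := hy
  obtain ⟨a, b, rfl⟩ := h.gen z
  have e : algebraMap K L y + algebraMap K L 0 * x =
      algebraMap K L (a * a + b * b * m) + algebraMap K L (2 * a * b) * x := by
    simp only [map_mul, map_add, map_zero, ← h.sq, map_ofNat]
    rw [hz]; ring
  obtain ⟨h1, h2⟩ := h.uniq e
  have h3 : a = 0 ∨ b = 0 := by
    have : a * b = 0 := by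
      have h4 : (2 : K) * (a * b) = 0 := by rw [← mul_assoc, ← h2]
      simpa using h4
    exact mul_eq_zero.1 this
  rcases h3 with rfl | rfl
  · right; exact ⟨b * m, by rw [h1]; ring⟩
  · left; exact ⟨a, by rw [h1]; ring⟩

lemma rat_int (L : Type*) [Field L] [NumberField L] (m k : ℤ) (hk : k ≠ 0) (z : 𝓞 L)
    (h : (m : 𝓞 L) = k * z) : k ∣ m := by
  have h1 : algebraMap ℚ L ((m : ℚ) / k) = algebraMap (𝓞 L) L z := by
    have h2 := congrArg (algebraMap (𝓞 L) L) h
    have hk' : (k : L) ≠ 0 := Int.cast_ne_zero.2 hk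
    simp only [map_mul, map_intCast] at h2
    rw [map_div₀, map_intCast, map_intCast, div_eq_iff hk', h2]; ring
  have h2 : IsIntegral ℤ ((m : ℚ) / k) := by
    have h3 : IsIntegral ℤ (algebraMap ℚ L ((m : ℚ) / k)) := by
      rw [h1]; exact z.isIntegral_coe
    exact (isIntegral_algebraMap_iff (algebraMap ℚ L).injective).1 h3
  obtain ⟨n, hn⟩ := IsIntegrallyClosed.isIntegral_iff.1 h2
  refine ⟨n, ?_⟩
  have hk' : (k : ℚ) ≠ 0 := Int.cast_ne_zero.2 hk
  rw [eq_div_iff hk'] at hn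
  have : (n : ℚ) * k = m := hn
  rw [mul_comm]
  exact_mod_cast this.symm

lemma OQ_int (n : 𝓞 ℚ) : ∃ k : ℤ, n = k :=
  ⟨Rat.ringOfIntegersEquiv n, by
    apply Rat.ringOfIntegersEquiv.injective
    simp⟩

lemma OQ_prime (q : ℕ) (hq : q.Prime) : Prime (q : 𝓞 ℚ) := by
  have := (MulEquiv.prime_iff Rat.ringOfIntegersEquiv (p := (q : 𝓞 ℚ)))
  rw [← this]
  simpa using Nat.prime_iff_prime_int.1 hq

lemma OQ_eq (q : ℕ) (hq : q.Prime) (P : Ideal (𝓞 ℚ)) [P.IsPrime] (h : (q : 𝓞 ℚ) ∈ P) :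
    P = Ideal.span {(q : 𝓞 ℚ)} := by
  have hp := OQ_prime q hq
  have h1 : (Ideal.span {(q : 𝓞 ℚ)}).IsPrime := (Ideal.span_singleton_prime hp.ne_zero).2 hp
  have h2 : (Ideal.span {(q : 𝓞 ℚ)}).IsMaximal := h1.isMaximal (by simpa using hp.ne_zero)
  exact (h2.eq_of_le (Ideal.IsPrime.ne_top inferInstance)
    ((Ideal.span_singleton_le_iff_mem _).2 h)).symm

lemma OQ_odd : Odd (Nat.card (ClassGroup (𝓞 ℚ))) := by
  have : Nat.card (ClassGroup (𝓞 ℚ)) = 1 := by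
    rw [Nat.card_eq_fintype_card]; exact Rat.classNumber_eq
  rw [this]; exact odd_one

lemma nat_mem_prime (q : ℕ) (hq : q.Prime) (P : Ideal (𝓞 L)) [P.IsPrime] (h : (q : 𝓞 L) ∈ P)
    (k : ℤ) (hk : (k : 𝓞 L) ∈ P) : (q : ℤ) ∣ k := by
  by_contra hn
  have hc : IsCoprime (q : ℤ) k := (Nat.prime_iff_prime_int.1 hq).irreducible.coprime_iff_not_dvd.2 hn
  obtain ⟨a, b, hab⟩ := hc
  apply (inferInstance : P.IsPrime).ne_top
  rw [Ideal.eq_top_iff_one]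
  have : (1 : 𝓞 L) = (a : 𝓞 L) * q + b * k := by exact_mod_cast hab.symm
  rw [this]
  exact P.add_mem (P.mul_mem_left _ h) (P.mul_mem_left _ hk)

lemma mem_ne_bot (q : ℕ) (hq : q ≠ 0) (P : Ideal (𝓞 L)) (h : (q : 𝓞 L) ∈ P) : P ≠ ⊥ := by
  rintro rfl
  rw [Ideal.mem_bot] at h
  exact hq (by exact_mod_cast h)

lemma smul_nat (σ : Gal(L/K)) (n : ℕ) : σ • (n : 𝓞 L) = n := by
  exact map_natCast (MulSemiringAction.toRingHom Gal(L/K) (𝓞 L) σ) n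

lemma nat_mem_smul (σ : Gal(L/K)) (P : Ideal (𝓞 L)) (n : ℕ) (h : (n : 𝓞 L) ∈ P) :
    (n : 𝓞 L) ∈ σ • P := by
  rw [← smul_nat σ n]
  exact Ideal.smul_mem_pointwise_smul σ _ _ h

lemma obstruct (D J : Ideal (𝓞 K)) [hDp : D.IsPrime] (hD0 : D ≠ ⊥) (d : 𝓞 K)
    (hJ : Ideal.span {d} = D * J) (hJD : ¬ D ∣ J) (u : 𝓞 K) (a b : K)
    (h : algebraMap (𝓞 K) K u = a ^ 2 - algebraMap (𝓞 K) K d * b ^ 2) :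
    ∃ e : 𝓞 K, u - e ^ 2 ∈ D := by
  have hDprime : Prime D := Ideal.prime_of_isPrime hD0 hDp
  have hinj := FaithfulSMul.algebraMap_injective (𝓞 K) K
  have hdD : d ∈ D := by
    have : Ideal.span {d} ≤ D := by rw [hJ]; exact Ideal.mul_le_left (I := D) (J := J)
    exact this (Ideal.mem_span_singleton_self d)
  let C : Ideal (𝓞 K) :=
    { carrier := {c | ∃ a' b' : 𝓞 K, algebraMap (𝓞 K) K a' = algebraMap (𝓞 K) K c * a ∧
        algebraMap (𝓞 K) K b' = algebraMap (𝓞 K) K c * b}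
      zero_mem' := ⟨0, 0, by simp, by simp⟩
      add_mem' := by
        rintro c c' ⟨x, y, h1, h2⟩ ⟨x', y', h1', h2'⟩
        exact ⟨x + x', y + y', by simp only [map_add, h1, h1']; ring,
          by simp only [map_add, h2, h2']; ring⟩
      smul_mem' := by
        rintro r c ⟨x, y, h1, h2⟩
        exact ⟨r * x, r * y, by simp only [map_mul, h1, smul_eq_mul]; ring,
          by simp only [map_mul, h2, smul_eq_mul]; ring⟩ }
  have hC0 : C ≠ ⊥ := by
    obtain ⟨m, hm, a', ha'⟩ := int_den a
    obtain ⟨n, hn, b', hb'⟩ := int_den b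
    intro h0
    have : ((m * n : ℤ) : 𝓞 K) ∈ C :=
      ⟨n * a', m * b', by simp only [map_mul, ha', map_intCast]; push_cast; ring,
        by simp only [map_mul, hb', map_intCast]; push_cast; ring⟩
    rw [h0, Ideal.mem_bot] at this
    exact mul_ne_zero hm hn (by exact_mod_cast this)
  -- the relation
  have hrel : ∀ c a' b' : 𝓞 K, algebraMap (𝓞 K) K a' = algebraMap (𝓞 K) K c * a →
      algebraMap (𝓞 K) K b' = algebraMap (𝓞 K) K c * b → c ^ 2 * u = a' ^ 2 - d * b' ^ 2 := by
    intro c a' b' h1 h2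
    apply hinj
    simp only [map_mul, map_sub, map_pow, h1, h2, h]; ring
  have hCD : ¬ C ≤ D := by
    intro hle
    obtain ⟨C', hC'⟩ := Ideal.dvd_iff_le.2 hle
    have hstep : ∀ c a' b' : 𝓞 K, c ∈ D → algebraMap (𝓞 K) K a' = algebraMap (𝓞 K) K c * a →
      algebraMap (𝓞 K) K b' = algebraMap (𝓞 K) K c * b → a' ∈ D ∧ b' ∈ D := by
      intro c a' b' hc h1 h2
      have hr := hrel c a' b' h1 h2
      have ha : a' ∈ D := by
        apply hDp.mem_of_pow_mem 2
        have : a' ^ 2 = c * (c * u) + d * b' ^ 2 := by linear_combination -hr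
        rw [this]
        exact D.add_mem (D.mul_mem_right _ hc) (D.mul_mem_right _ hdD)
      refine ⟨ha, ?_⟩
      have h3 : d * b' ^ 2 ∈ D * D := by
        have : d * b' ^ 2 = a' * a' - (c * c) * u := by linear_combination hr
        rw [this]
        exact Ideal.sub_mem _ (Ideal.mul_mem_mul ha ha)
          (Ideal.mul_mem_right _ _ (Ideal.mul_mem_mul hc hc))
      rw [← Ideal.span_singleton_le_iff_mem, ← Ideal.dvd_iff_le,
        ← Ideal.span_singleton_mul_span_singleton, hJ, mul_assoc] at h3
      have h4 := (mul_dvd_mul_iff_left hD0).1 h3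
      rcases hDprime.dvd_or_dvd h4 with h5 | h5
      · exact absurd h5 hJD
      · rw [Ideal.dvd_iff_le, Ideal.span_singleton_le_iff_mem] at h5
        exact hDp.mem_of_pow_mem 2 h5
    have hintg : ∀ y : K, (∀ x ∈ D, ∃ z ∈ D, algebraMap (𝓞 K) K z = y * algebraMap (𝓞 K) K x) →
        ∃ w : 𝓞 K, algebraMap (𝓞 K) K w = y := by
      intro y hy
      have : IsIntegral (𝓞 K) y := by
        refine isIntegral_of_smul_mem_submodule (M := K)
          (Submodule.map (Algebra.linearMap (𝓞 K) K) D) ?_ ?_ y ?_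
        · intro h0
          obtain ⟨z, hz, hz0⟩ := Submodule.exists_mem_ne_zero_of_ne_bot hD0
          have : Algebra.linearMap (𝓞 K) K z ∈ Submodule.map (Algebra.linearMap (𝓞 K) K) D :=
            ⟨z, hz, rfl⟩
          rw [h0, Submodule.mem_bot] at this
          exact hz0 (hinj (by rw [map_zero]; exact this))
        · exact Submodule.FG.map _ (IsNoetherian.noetherian D)
        · rintro n ⟨x, hx, rfl⟩
          obtain ⟨z, hz, hz2⟩ := hy x hx
          exact ⟨z, hz, hz2⟩
      exact IsIntegrallyClosed.isIntegral_iff.1 this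
    have hle2 : C' ≤ C := by
      intro c hc
      have hin : ∀ x ∈ D, x * c ∈ C := fun x hx => by
        rw [hC']; exact Ideal.mul_mem_mul hx hc
      obtain ⟨a', ha'⟩ := hintg (algebraMap (𝓞 K) K c * a) (by
        intro x hx
        obtain ⟨p, q, h1, h2⟩ := hin x hx
        refine ⟨p, (hstep _ p q (D.mul_mem_right _ hx) h1 h2).1, ?_⟩
        rw [h1, map_mul]; ring)
      obtain ⟨b', hb'⟩ := hintg (algebraMap (𝓞 K) K c * b) (by
        intro x hx
        obtain ⟨p, q, h1, h2⟩ := hin x hx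
        refine ⟨q, (hstep _ p q (D.mul_mem_right _ hx) h1 h2).2, ?_⟩
        rw [h2, map_mul]; ring)
      exact ⟨a', b', ha', hb'⟩
    have h1 : C = C' := le_antisymm (by rw [hC']; exact Ideal.mul_le_right) hle2
    rw [← h1] at hC'
    have h2 : D * C = 1 * C := by rw [one_mul]; exact hC'.symm
    have h3 := mul_right_cancel₀ hC0 h2
    exact hDp.ne_top (by rw [h3, Ideal.one_eq_top])
  obtain ⟨c, ⟨a', b', h1, h2⟩, hc⟩ := SetLike.not_le_iff_exists.1 hCD
  have hr := hrel c a' b' h1 h2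
  have hDm : D.IsMaximal := hDp.isMaximal hD0
  obtain ⟨y, i, hi, hyi⟩ := hDm.exists_inv hc
  refine ⟨y * a', ?_⟩
  have : u - (y * a') ^ 2 = i * (u * (1 + y * c)) - d * (b' ^ 2 * y ^ 2) := by
    have e : i = 1 - y * c := by linear_combination hyi
    rw [e]
    linear_combination y ^ 2 * hr
  rw [this]
  exact D.sub_mem (D.mul_mem_right _ hi) (D.mul_mem_right _ hdD)

end Setup
end PartP5a

section PartP5b
open NumberField
open scoped Pointwise nonZeroDivisors

section StepA
set_option linter.unusedSectionVars false
variable {K L : Type*} [Field K] [NumberField K] [Field L] [NumberField L] [Algebra K L]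

lemma coe_smulO (σ : Gal(L/K)) (x : 𝓞 L) :
    algebraMap (𝓞 L) L (σ • x) = σ (algebraMap (𝓞 L) L x) := rfl

lemma injO : Function.Injective (algebraMap (𝓞 L) L) := FaithfulSMul.algebraMap_injective (𝓞 L) L

lemma algO (a : 𝓞 K) : algebraMap (𝓞 L) L (algebraMap (𝓞 K) (𝓞 L) a) =
    algebraMap K L (algebraMap (𝓞 K) K a) := rfl

lemma exists_quad (x : L) (b c : 𝓞 L)
    (h : x ^ 2 = algebraMap (𝓞 L) L b * x + algebraMap (𝓞 L) L c) :
    ∃ X : 𝓞 L, algebraMap (𝓞 L) L X = x ∧ X ^ 2 = b * X + c := by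
  have hi : IsIntegral (𝓞 L) x := by
    refine ⟨Polynomial.X ^ 2 - (Polynomial.C b * Polynomial.X + Polynomial.C c), ?_, ?_⟩
    · apply Polynomial.monic_X_pow_sub
      refine lt_of_le_of_lt (Polynomial.degree_linear_le) ?_
      norm_num
    · simp [h]
  obtain ⟨X, hX⟩ := IsIntegrallyClosed.isIntegral_iff.1 hi
  refine ⟨X, hX, ?_⟩
  apply injO
  simp only [map_pow, map_mul, map_add, hX, h]

lemma QuadExt.nm {x : L} {m : K} (h : QuadExt K L x m) (σ : Gal(L/K)) (hx : σ x = -x) (y : L) :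
    ∃ a b : K, y * σ y = algebraMap K L (a ^ 2 - m * b ^ 2) := by
  obtain ⟨a, b, rfl⟩ := h.gen y
  refine ⟨a, b, ?_⟩
  simp only [map_add, map_mul, hx, AlgEquiv.commutes, map_sub, map_pow, ← h.sq]
  ring

lemma nat_mem_under (P : Ideal (𝓞 L)) (n : ℕ) (h : (n : 𝓞 L) ∈ P) :
    (n : 𝓞 K) ∈ P.under (𝓞 K) := by
  rw [Ideal.under_def, Ideal.mem_comap, map_natCast]; exact h

lemma smul_intcast (σ : Gal(L/K)) (n : ℤ) : σ • (n : 𝓞 L) = n :=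
  map_intCast (MulSemiringAction.toRingHom Gal(L/K) (𝓞 L) σ) n

lemma stepA (p : ℕ) (hp : p.Prime) (hp8 : p % 8 = 5) (r : L) (h : QuadExt ℚ L r (p : ℚ)) :
    IsTotallyReal L ∧ Odd (Nat.card (ClassGroup (𝓞 L))) ∧ IsGalois ℚ L ∧
    ∃ σ : Gal(L/ℚ), (∀ g, g = 1 ∨ g = σ) ∧ σ ≠ 1 ∧ σ r = -r ∧
      (∃ ε : (𝓞 L)ˣ, (ε : 𝓞 L) * σ • (ε : 𝓞 L) = -1) ∧
      (∀ P : Ideal (𝓞 L), P.IsPrime → (2 : 𝓞 L) ∈ P → P = Ideal.span {2}) ∧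
      (∀ P : Ideal (𝓞 L), P.IsPrime → ∀ q : ℕ, q.Prime → q ≠ p → (q : 𝓞 L) ∈ P →
        (σ • P = P ∧ Ideal.span {(q : 𝓞 L)} = P) ∨
        (σ • P ≠ P ∧ Ideal.span {(q : 𝓞 L)} = P * σ • P)) := by
  obtain ⟨hG, hdeg, σ, hσ, hσ1, hσr⟩ := h.setup
  have hTR : IsTotallyReal L := h.totReal (fun φ => ⟨p, by positivity, by simp⟩)
  have hr2 : r ^ 2 = (p : L) := by rw [h.sq, map_natCast]
  obtain ⟨k, hk⟩ : ∃ k : ℤ, (p : ℤ) = 4 * k + 1 := ⟨(p : ℤ) / 4, by omega⟩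
  have hkodd : k % 2 = 1 := by omega
  have hkL : (p : L) = 4 * (k : L) + 1 := by exact_mod_cast congrArg (Int.cast : ℤ → L) hk
  obtain ⟨W, hW, hW2⟩ := exists_quad ((1 + r) / 2) 1 (k : 𝓞 L) (by
    rw [map_one, map_intCast]
    have : r ^ 2 = 4 * (k : L) + 1 := by rw [hr2, hkL]
    linear_combination this / 4)
  obtain ⟨R, hR, hR2⟩ := exists_quad r 0 (p : 𝓞 L) (by rw [map_zero, map_natCast, hr2]; ring)
  have hR2' : R * R = p := by rw [← sq, hR2]; ring
  have hWs : σ • W - W = -R := by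
    apply injO
    rw [map_sub, coe_smulO, hW, map_neg, hR, map_div₀, map_add, map_one, hσr, map_ofNat]
    ring
  have hWs2 : σ • W = 1 - W := by
    apply injO
    rw [map_sub, coe_smulO, hW, map_one, map_div₀, map_add, map_one, hσr, map_ofNat]
    ring
  have hpmem : ∀ P : Ideal (𝓞 L), σ • W - W ∈ P → (p : 𝓞 L) ∈ P := by
    intro P hP
    rw [hWs, neg_mem_iff] at hP
    rw [← hR2']; exact P.mul_mem_left _ hP
  have hgen : ∀ P : Ideal (𝓞 L), P.IsPrime → ∀ q : ℕ, q.Prime → q ≠ p → (q : 𝓞 L) ∈ P →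
        (σ • P = P ∧ Ideal.span {(q : 𝓞 L)} = P) ∨
        (σ • P ≠ P ∧ Ideal.span {(q : 𝓞 L)} = P * σ • P) := by
    intro P hP q hq hqp hqP
    have hPu : P.under (𝓞 ℚ) = Ideal.span {(q : 𝓞 ℚ)} := OQ_eq q hq _ (nat_mem_under P q hqP)
    have hmap : Ideal.map (algebraMap (𝓞 ℚ) (𝓞 L)) (P.under (𝓞 ℚ)) = Ideal.span {(q : 𝓞 L)} := by
      rw [hPu, Ideal.map_span, Set.image_singleton, map_natCast]
    rcases tri σ hσ hσ1 P (mem_ne_bot q hq.ne_zero P hqP) with ⟨h1, h2⟩ | ⟨h1, h2⟩ | ⟨_, _, h3⟩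
    · right; exact ⟨h1, by rw [← hmap, h2]⟩
    · left; exact ⟨h1, by rw [← hmap, h2]⟩
    · exfalso
      have := nat_mem_prime q hq P hqP p (by exact_mod_cast hpmem P (h3 W))
      exact hqp ((Nat.prime_dvd_prime_iff_eq hq hp).1 (by exact_mod_cast this))
  have hmain := main_odd σ hσ hσ1 {Ideal.span {(p : 𝓞 ℚ)}} (by
    intro P hP hP0 hPT
    refine ⟨W, fun hm => hPT ?_⟩
    rw [Finset.mem_singleton]
    exact OQ_eq p hp _ (nat_mem_under P p (hpmem P hm))) OQ_odd hdeg {1} (by simp) (by simp)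
    (by
      intro u hu v hv huv
      rw [Finset.mem_singleton] at hu hv
      exact absurd (hu.trans hv.symm) huv)
  refine ⟨hTR, hmain.1, hG, σ, hσ, hσ1, hσr, ?_, ?_, hgen⟩
  · obtain ⟨v, hv, η, hη⟩ := hmain.2 (-1)
    rw [Finset.mem_singleton] at hv
    refine ⟨η, ?_⟩
    have := congrArg Units.val hη
    rw [hv, map_one, one_mul, Units.val_mul, uAct_val, uInc_val] at this
    rw [← this]; simp
  · intro P hP h2
    have h2' : ((2 : ℕ) : 𝓞 L) ∈ P := by exact_mod_cast h2
    rcases hgen P hP 2 Nat.prime_two (by omega) h2' with ⟨_, h3⟩ | ⟨h3, _⟩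
    · rw [← h3]; simp
    · exfalso
      obtain ⟨a, ha⟩ := split_residue σ hσ hσ1 P (mem_ne_bot 2 two_ne_zero P h2') h3 W
      obtain ⟨n, rfl⟩ := OQ_int a
      rw [map_intCast] at ha
      have h4 : ((k + n - n * n : ℤ) : 𝓞 L) ∈ P := by
        have : ((k + n - n * n : ℤ) : 𝓞 L) = (W - n) * (W + n - 1) := by
          push_cast; linear_combination -hW2
        rw [this]; exact P.mul_mem_right _ ha
      have h5 := nat_mem_prime 2 Nat.prime_two P h2' _ h4
      have h6 : n * n % 2 = n % 2 := by
        rcases Int.emod_two_eq_zero_or_one n with h | h <;> simp [Int.mul_emod, h]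
      push_cast at h5
      omega
end StepA
end PartP5b

section PartP5c
open NumberField
open scoped Pointwise nonZeroDivisors

section StepB
set_option linter.unusedSectionVars false
variable {K L : Type*} [Field K] [NumberField K] [Field L] [NumberField L] [Algebra K L]

lemma exists_prime_over (q : ℕ) (hq : q.Prime) : ∃ P : Ideal (𝓞 L), P.IsPrime ∧ (q : 𝓞 L) ∈ P := by
  have hne : Ideal.span {(q : 𝓞 L)} ≠ ⊤ := by
    intro h
    rw [Ideal.span_singleton_eq_top] at h
    obtain ⟨z, hz⟩ := h.exists_right_inv
    have := rat_int L 1 q (by exact_mod_cast hq.ne_zero) z (by push_cast; exact hz.symm)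
    have h1 : q ∣ 1 := by exact_mod_cast this
    exact hq.one_lt.ne' (Nat.dvd_one.1 h1)
  obtain ⟨P, hP, hle⟩ := Ideal.exists_le_maximal _ hne
  exact ⟨P, hP.isPrime, hle (Ideal.mem_span_singleton_self _)⟩

lemma neg_one_mod (d : ℕ) (hd : d.Prime) (hd4 : d % 4 = 3) (D : Ideal (𝓞 L)) [D.IsPrime]
    (hdD : (d : 𝓞 L) ∈ D) (n : ℤ) (h : (-1 : 𝓞 L) - (n : 𝓞 L) ^ 2 ∈ D) : False := by
  have h1 : ((-1 - n ^ 2 : ℤ) : 𝓞 L) ∈ D := by push_cast; exact h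
  have h2 := nat_mem_prime d hd D hdD _ h1
  have : Fact d.Prime := ⟨hd⟩
  have h3 := (ZMod.intCast_zmod_eq_zero_iff_dvd (-1 - n ^ 2) d).2 h2
  have h4 : IsSquare (-1 : ZMod d) := ⟨(n : ZMod d), by push_cast at h3; linear_combination h3⟩
  exact ZMod.exists_sq_eq_neg_one_iff.1 h4 hd4

lemma mem_smul_iff2 [IsGalois K L] (σ : Gal(L/K)) (hσ : ∀ g : Gal(L/K), g = 1 ∨ g = σ) (hσ1 : σ ≠ 1)
    (P : Ideal (𝓞 L)) (x : 𝓞 L) : x ∈ σ • P ↔ σ • x ∈ P := by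
  constructor
  · intro h
    have h1 := Ideal.smul_mem_pointwise_smul σ x (σ • P) h
    rw [← mul_smul] at h1
    have : σ * σ = 1 := by
      rcases hσ (σ * σ) with h | h
      · exact h
      · exact absurd (mul_eq_left.1 h) hσ1
    rwa [this, one_smul] at h1
  · intro h
    have h1 := Ideal.smul_mem_pointwise_smul σ (σ • x) P h
    rwa [smul_smul_sig σ hσ hσ1] at h1

lemma uAct_neg [IsGalois K L] (σ : Gal(L/K)) (u : (𝓞 L)ˣ) : uAct σ (-u) = - uAct σ u := by
  ext
  rw [uAct_val, Units.val_neg, Units.val_neg, smul_neg, uAct_val]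

variable {F : Type*} [Field F] [NumberField F] [Algebra F L]

lemma isPrime_smulI (σ : Gal(L/K)) (P : Ideal (𝓞 L)) [P.IsPrime] : (σ • P).IsPrime := inferInstance

open Classical in
lemma stepB1 [IsGalois ℚ F] [IsTotallyReal F] (hF : Odd (Nat.card (ClassGroup (𝓞 F))))
    (σ : Gal(F/ℚ)) (hσ : ∀ g, g = 1 ∨ g = σ) (hσ1 : σ ≠ 1)
    (ε : (𝓞 F)ˣ) (hε : (ε : 𝓞 F) * σ • (ε : 𝓞 F) = -1)
    (h2F : ∀ P : Ideal (𝓞 F), P.IsPrime → (2 : 𝓞 F) ∈ P → P = Ideal.span {2})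
    (d : ℕ) (hd : d.Prime) (hd4 : d % 4 = 3)
    (hdF : ∀ P : Ideal (𝓞 F), P.IsPrime → (d : 𝓞 F) ∈ P →
        (σ • P = P ∧ Ideal.span {(d : 𝓞 F)} = P) ∨
        (σ • P ≠ P ∧ Ideal.span {(d : 𝓞 F)} = P * σ • P))
    (t : L) (h : QuadExt F L t (d : F)) :
    ∃ (T : Finset (Ideal (𝓞 F))) (s : Finset (𝓞 F)ˣ), 2 ^ T.card ≤ 2 * s.card ∧ 1 ∈ s ∧
      (∀ Q : Ideal (𝓞 F), Q.IsPrime → ((2 : 𝓞 F) ∈ Q ∨ (d : 𝓞 F) ∈ Q) → Q ∈ T) ∧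
      (∀ u ∈ s, ∀ v ∈ s, u ≠ v → ∀ a b : F,
        algebraMap (𝓞 F) F ((u * v⁻¹ : (𝓞 F)ˣ) : 𝓞 F) ≠
          a ^ 2 - algebraMap (𝓞 F) F (d : 𝓞 F) * b ^ 2) := by
  obtain ⟨D, hDp, hdD⟩ := exists_prime_over (L := F) d hd
  have hD0 : D ≠ ⊥ := mem_ne_bot d hd.ne_zero D hdD
  have hDs : ∀ Q : Ideal (𝓞 F), Q.IsPrime → (d : 𝓞 F) ∈ Q → Q = D ∨ Q = σ • D := by
    intro Q hQ hQd
    apply prime_trans σ hσ D Q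
    rw [OQ_eq d hd _ (nat_mem_under D d hdD), OQ_eq d hd _ (nat_mem_under Q d hQd)]
  have hε' : ε * uAct σ ε = -1 := by
    ext; rw [Units.val_mul, uAct_val, hε]; simp
  have hN : ∀ w : (𝓞 F)ˣ, w * uAct σ w = -1 → (w : 𝓞 F) * σ • (w : 𝓞 F) = -1 := by
    intro w hw
    have := congrArg Units.val hw
    simpa [uAct_val] using this
  have hσε : uAct σ ε = -ε⁻¹ := by
    rw [← mul_right_inj ε, hε']; simp
  rcases hdF D hDp hdD with ⟨hsD, hspan⟩ | ⟨hsD, hspan⟩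
  · refine ⟨{Ideal.span {2}, D}, {1, ε}, ?_, by simp, ?_, ?_⟩
    · have h1 : (1 : (𝓞 F)ˣ) ≠ ε := by
        rintro rfl
        rw [map_one, mul_one] at hε'
        have := congrArg Units.val hε'
        have h3 : (1 : 𝓞 F) = -1 := by simpa using this
        have h4 : (2 : 𝓞 F) = 0 := by linear_combination h3
        exact two_ne_zero h4
      rw [Finset.card_pair h1]
      calc 2 ^ _ ≤ 2 ^ 2 := Nat.pow_le_pow_right (by norm_num) Finset.card_le_two
        _ = _ := by norm_num
    · rintro Q hQ (h1 | h1)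
      · rw [h2F Q hQ h1]; simp
      · rcases hDs Q hQ h1 with rfl | rfl
        · simp
        · rw [hsD]; simp
    · intro u hu v hv huv a b hab
      have hw : (u * v⁻¹) * uAct σ (u * v⁻¹) = -1 := by
        simp only [Finset.mem_insert, Finset.mem_singleton] at hu hv
        rcases hu with rfl | rfl <;> rcases hv with rfl | rfl
        · exact absurd rfl huv
        · rw [map_mul, map_inv, hσε]; simp
        · rw [map_mul, map_inv, hσε]; simp
        · exact absurd rfl huv
      obtain ⟨e, he⟩ := obstruct D ⊤ hD0 (d : 𝓞 F) (by rw [hspan, Ideal.mul_top])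
        (by rw [Ideal.dvd_iff_le]; exact fun h => hDp.ne_top (top_le_iff.1 h)) _ a b hab
      set w : 𝓞 F := ((u * v⁻¹ : (𝓞 F)ˣ) : 𝓞 F)
      have hw' := hN _ hw
      have he2 : σ • w - (σ • e) ^ 2 ∈ D := by
        have := Ideal.smul_mem_pointwise_smul σ _ D he
        rwa [hsD, smul_sub, smul_pow'] at this
      obtain ⟨n, hn⟩ := exists_of_fixed σ hσ (e * σ • e) (by
        rw [smul_mul', smul_smul_sig σ hσ hσ1, mul_comm])
      obtain ⟨k, rfl⟩ := OQ_int n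
      rw [map_intCast] at hn
      apply neg_one_mod d hd hd4 D hdD k
      rw [hn]
      have : (-1 : 𝓞 F) - (e * σ • e) ^ 2 = (w - e ^ 2) * σ • w + e ^ 2 * (σ • w - (σ • e) ^ 2) := by
        rw [← hw']; ring
      rw [this]
      exact D.add_mem (D.mul_mem_right _ he) (D.mul_mem_left _ he2)
  · have hpi := isPrime_smulI σ D
    refine ⟨{Ideal.span {2}, D, σ • D}, {1, -1, ε, -ε}, ?_, by simp, ?_, ?_⟩
    · have e2 : (-1 : (𝓞 F)ˣ) ≠ 1 := by
        intro h
        have := congrArg Units.val h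
        have h3 : (-1 : 𝓞 F) = 1 := by simpa using this
        have h4 : (2 : 𝓞 F) = 0 := by linear_combination -h3
        exact two_ne_zero h4
      have e1 : ε ≠ 1 := by
        rintro rfl
        rw [map_one, mul_one] at hε'
        exact e2 hε'.symm
      have e3 : ε ≠ -1 := by
        rintro rfl
        rw [uAct_neg, map_one] at hε'
        exact e2 (by simpa using hε'.symm)
      have e4 : ε ≠ -ε := by
        intro h
        apply e2
        have := congrArg (fun z => ε⁻¹ * z) h
        simpa using this.symm
      have hc : ({1, -1, ε, -ε} : Finset (𝓞 F)ˣ).card = 4 := by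
        rw [Finset.card_insert_of_notMem, Finset.card_insert_of_notMem, Finset.card_pair e4]
        · simp only [Finset.mem_insert, Finset.mem_singleton, not_or]
          refine ⟨e3.symm, fun h => e1 (neg_injective h).symm⟩
        · simp only [Finset.mem_insert, Finset.mem_singleton, not_or]
          refine ⟨e2.symm, e1.symm, fun h => e3 (by rw [h, neg_neg])⟩
      rw [hc]
      calc 2 ^ _ ≤ 2 ^ 3 := Nat.pow_le_pow_right (by norm_num) Finset.card_le_three
        _ = _ := by norm_num
    · rintro Q hQ (h1 | h1)
      · rw [h2F Q hQ h1]; simp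
      · rcases hDs Q hQ h1 with rfl | rfl <;> simp
    · intro u hu v hv huv a b hab
      have hfin : ∀ e : 𝓞 F, (-1 : 𝓞 F) - e ^ 2 ∈ D → False := by
        intro e he
        obtain ⟨n, hn⟩ := split_residue σ hσ hσ1 D hD0 hsD e
        obtain ⟨k, rfl⟩ := OQ_int n
        rw [map_intCast] at hn
        apply neg_one_mod d hd hd4 D hdD k
        have : (-1 : 𝓞 F) - (k : 𝓞 F) ^ 2 = (-1 - e ^ 2) + (e - k) * (e + k) := by ring
        rw [this]
        exact D.add_mem he (D.mul_mem_right _ hn)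
      have hnd : ∀ P Q : Ideal (𝓞 F), P.IsPrime → Q.IsPrime → Q ≠ ⊥ → P ≠ Q → ¬ P ∣ Q := by
        intro P Q hP hQ hQ0 hne hdv
        exact hne ((hQ.isMaximal hQ0).eq_of_le hP.ne_top (Ideal.dvd_iff_le.1 hdv)).symm
      obtain ⟨e, he⟩ := obstruct D (σ • D) hD0 (d : 𝓞 F) hspan
        (hnd _ _ hDp hpi (smul_ne_bot σ hD0) hsD.symm) _ a b hab
      obtain ⟨f, hf⟩ := obstruct (σ • D) D (smul_ne_bot σ hD0) (d : 𝓞 F)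
        (by rw [hspan, mul_comm]) (hnd _ _ hpi hDp hD0 hsD) _ a b hab
      have hw : (u * v⁻¹) = -1 ∨ (u * v⁻¹) * uAct σ (u * v⁻¹) = -1 := by
        simp only [Finset.mem_insert, Finset.mem_singleton] at hu hv
        rcases hu with rfl | rfl | rfl | rfl <;> rcases hv with rfl | rfl | rfl | rfl <;>
        first
        | exact absurd rfl huv
        | (left; simp; done)
        | (right; simp [map_mul, map_inv, uAct_neg, hσε]; done)
      rcases hw with hw | hw
      · rw [hw] at he
        exact hfin e (by simpa using he)
      · set w : 𝓞 F := ((u * v⁻¹ : (𝓞 F)ˣ) : 𝓞 F)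
        have hw' := hN _ hw
        rw [mem_smul_iff2 σ hσ hσ1, smul_sub, smul_pow'] at hf
        apply hfin (e * σ • f)
        have : (-1 : 𝓞 F) - (e * σ • f) ^ 2 =
            (w - e ^ 2) * σ • w + e ^ 2 * (σ • w - (σ • f) ^ 2) := by
          rw [← hw']; ring
        rw [this]
        exact D.add_mem (D.mul_mem_right _ he) (D.mul_mem_left _ hf)
end StepB
end PartP5c

section PartP5d
open NumberField
open scoped Pointwise nonZeroDivisors

section StepD
set_option linter.unusedSectionVars false
variable {K L : Type*} [Field K] [NumberField K] [Field L] [NumberField L] [Algebra K L]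

lemma uniq_two [IsGalois K L] (σ : Gal(L/K)) (hσ : ∀ g : Gal(L/K), g = 1 ∨ g = σ)
    (hu : ∀ P Q : Ideal (𝓞 K), P.IsPrime → Q.IsPrime → (2 : 𝓞 K) ∈ P → (2 : 𝓞 K) ∈ Q → P = Q)
    (hs : ∀ P : Ideal (𝓞 L), P.IsPrime → (2 : 𝓞 L) ∈ P → σ • P = P) :
    ∀ P Q : Ideal (𝓞 L), P.IsPrime → Q.IsPrime → (2 : 𝓞 L) ∈ P → (2 : 𝓞 L) ∈ Q → P = Q := by
  intro P Q hP hQ h2P h2Q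
  have hPu : (2 : 𝓞 K) ∈ P.under (𝓞 K) := by
    exact_mod_cast nat_mem_under (K := K) P 2 (by exact_mod_cast h2P)
  have hQu : (2 : 𝓞 K) ∈ Q.under (𝓞 K) := by
    exact_mod_cast nat_mem_under (K := K) Q 2 (by exact_mod_cast h2Q)
  have h1 := hu _ _ inferInstance inferInstance hPu hQu
  rcases prime_trans σ hσ P Q h1 with h | h
  · exact h.symm
  · rw [h, hs P hP h2P]

lemma split_inter [IsGalois K L] (σ : Gal(L/K)) (P : Ideal (𝓞 L)) [hP : P.IsPrime] (hP0 : P ≠ ⊥)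
    (hs : σ • P ≠ P) (x : 𝓞 L) (h1 : x ∈ P) (h2 : x ∈ σ • P) : x ∈ P * σ • P := by
  have hpi := isPrime_smulI σ P
  have hs0 : σ • P ≠ ⊥ := smul_ne_bot σ hP0
  have hPm : P.IsMaximal := hP.isMaximal hP0
  have hsm : (σ • P).IsMaximal := hpi.isMaximal hs0
  have hco : P ⊔ σ • P = ⊤ := Ideal.isCoprime_iff_sup_eq.1 (Ideal.isCoprime_of_isMaximal hs.symm)
  rw [Ideal.mul_eq_inf_of_isCoprime (Ideal.isCoprime_iff_sup_eq.2 hco)]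
  exact ⟨h1, h2⟩

lemma two_coe (x : 𝓞 L) (h : x ^ 2 = 2) (P : Ideal (𝓞 L)) [P.IsPrime] (h1 : x ∈ P) :
    (2 : 𝓞 L) ∈ P := by
  rw [← h, sq]; exact P.mul_mem_left _ h1

variable {F : Type*} [Field F] [NumberField F] [Algebra F L]

lemma stepB [IsGalois ℚ F] [IsTotallyReal F] (hF : Odd (Nat.card (ClassGroup (𝓞 F))))
    (σ : Gal(F/ℚ)) (hσ : ∀ g, g = 1 ∨ g = σ) (hσ1 : σ ≠ 1)
    (ε : (𝓞 F)ˣ) (hε : (ε : 𝓞 F) * σ • (ε : 𝓞 F) = -1)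
    (h2F : ∀ P : Ideal (𝓞 F), P.IsPrime → (2 : 𝓞 F) ∈ P → P = Ideal.span {2})
    (d : ℕ) (hd : d.Prime) (hd4 : d % 4 = 3)
    (hdF : ∀ P : Ideal (𝓞 F), P.IsPrime → (d : 𝓞 F) ∈ P →
        (σ • P = P ∧ Ideal.span {(d : 𝓞 F)} = P) ∨
        (σ • P ≠ P ∧ Ideal.span {(d : 𝓞 F)} = P * σ • P))
    (t : L) (h : QuadExt F L t (d : F)) :
    IsTotallyReal L ∧ Odd (Nat.card (ClassGroup (𝓞 L))) ∧
    (∀ P Q : Ideal (𝓞 L), P.IsPrime → Q.IsPrime → (2 : 𝓞 L) ∈ P → (2 : 𝓞 L) ∈ Q → P = Q) ∧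
    (∀ P : Ideal (𝓞 L), P.IsPrime → (2 : 𝓞 L) ∈ P → P ^ 2 ≤ Ideal.span {2}) := by
  obtain ⟨hG, hdeg, τ, hτ, hτ1, hτt⟩ := h.setup
  have hTR : IsTotallyReal L := h.totReal (fun φ => ⟨d, by positivity, by simp⟩)
  obtain ⟨R, hR, hR2⟩ := exists_quad t 0 (d : 𝓞 L) (by
    rw [map_zero, map_natCast, h.sq, map_natCast]; ring)
  have hR2' : R * R = d := by rw [← sq, hR2]; ring
  have hτR : τ • R = -R := by
    apply injO
    rw [coe_smulO, hR, map_neg, hR, hτt]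
  obtain ⟨T, s, hc, h1s, hT, hH⟩ := stepB1 hF σ hσ hσ1 ε hε h2F d hd hd4 hdF t h
  have hmain := main_odd τ hτ hτ1 T (by
    intro P hP hP0 hPT
    refine ⟨R, fun hm => hPT (hT _ inferInstance ?_)⟩
    rw [hτR] at hm
    have hm2 : (2 : 𝓞 L) * R ∈ P := by
      have : (2 : 𝓞 L) * R = -(-R - R) := by ring
      rw [this]; exact P.neg_mem hm
    rcases hP.mem_or_mem hm2 with h2 | h2
    · left; exact_mod_cast nat_mem_under (K := F) P 2 (by exact_mod_cast h2)
    · right; exact nat_mem_under (K := F) P d (by rw [← hR2']; exact P.mul_mem_left _ h2))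
    hF hdeg s hc h1s (by
      intro u hu v hv huv x hx
      obtain ⟨a, b, hab⟩ := h.nm τ hτt x
      apply hH u hu v hv huv a b
      rw [hab, ← map_mul] at hx
      have hx2 := (algebraMap F L).injective hx
      have hv0 : algebraMap (𝓞 F) F (v : 𝓞 F) ≠ 0 := by
        intro h0
        exact v.ne_zero (injO (by rw [h0, map_zero]))
      have hvi : algebraMap (𝓞 F) F (v : 𝓞 F) * algebraMap (𝓞 F) F ((v⁻¹ : (𝓞 F)ˣ) : 𝓞 F) = 1 := by
        rw [← map_mul, Units.mul_inv, map_one]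
      rw [Units.val_mul, map_mul, hx2, map_natCast]
      linear_combination (a ^ 2 - d * b ^ 2) * hvi)
  have hmap : ∀ P : Ideal (𝓞 L), P.IsPrime → (2 : 𝓞 L) ∈ P →
      Ideal.map (algebraMap (𝓞 F) (𝓞 L)) (P.under (𝓞 F)) = Ideal.span {2} := by
    intro P hP h2
    rw [h2F (P.under (𝓞 F)) inferInstance
      (by exact_mod_cast nat_mem_under (K := F) P 2 (by exact_mod_cast h2)), Ideal.map_span,
      Set.image_singleton, map_ofNat]
  have htri : ∀ P : Ideal (𝓞 L), P.IsPrime → (2 : 𝓞 L) ∈ P →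
      τ • P = P ∧ P ^ 2 ≤ Ideal.span {2} := by
    intro P hP h2
    have hP0 : P ≠ ⊥ := mem_ne_bot 2 two_ne_zero P (by exact_mod_cast h2)
    rcases tri τ hτ hτ1 P hP0 with ⟨h3, h4⟩ | ⟨h3, h4⟩ | ⟨h3, h4, _⟩
    · exfalso
      rw [hmap P hP h2] at h4
      obtain ⟨k, hk⟩ : ∃ k : ℤ, (d : ℤ) = 2 * k + 1 := ⟨(d : ℤ) / 2, by omega⟩
      have hkL : (d : 𝓞 L) = 2 * (k : 𝓞 L) + 1 := by exact_mod_cast congrArg (Int.cast : ℤ → 𝓞 L) hk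
      have hx : ∀ Q : Ideal (𝓞 L), Q.IsPrime → (2 : 𝓞 L) ∈ Q → 1 + R ∈ Q := by
        intro Q hQ hQ2
        apply hQ.mem_of_pow_mem 2
        have : (1 + R) ^ 2 = 2 * (1 + R + k) := by linear_combination hR2' + hkL
        rw [this]; exact Q.mul_mem_right _ hQ2
      have hin := split_inter τ P hP0 h3 (1 + R) (hx P hP h2) (hx _ (isPrime_smulI τ P) (by
        exact_mod_cast nat_mem_smul τ P 2 (by exact_mod_cast h2)))
      rw [← h4, Ideal.mem_span_singleton] at hin
      obtain ⟨y, hy⟩ := hin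
      have hy2 : 1 - R = 2 * τ • y := by
        have := congrArg (fun z => τ • z) hy
        simp only [smul_add, smul_one, hτR, smul_mul'] at this
        have e2 : τ • (2 : 𝓞 L) = 2 := by exact_mod_cast smul_nat τ 2
        rw [e2] at this
        rw [← this]; ring
      have := rat_int L (1 - d) 4 (by norm_num) (y * τ • y) (by
        push_cast
        rw [← hR2']
        linear_combination (1 - R) * hy + 2 * y * hy2)
      omega
    · refine ⟨h3, ?_⟩
      rw [← hmap P hP h2, h4]
      exact Ideal.pow_le_self two_ne_zero
    · exact ⟨h3, by rw [← hmap P hP h2, h4]⟩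
  refine ⟨hTR, hmain.1, ?_, fun P hP h2 => (htri P hP h2).2⟩
  apply uniq_two τ hτ
  · intro P Q hP hQ h1 h2
    rw [h2F P hP h1, h2F Q hQ h2]
  · exact fun P hP h2 => (htri P hP h2).1

/-- `K₁ = K₀(√2)`. -/
lemma stepD [IsTotallyReal K] (hK : Odd (Nat.card (ClassGroup (𝓞 K))))
    (hu : ∀ P Q : Ideal (𝓞 K), P.IsPrime → Q.IsPrime → (2 : 𝓞 K) ∈ P → (2 : 𝓞 K) ∈ Q → P = Q)
    (hsq : ∀ P : Ideal (𝓞 K), P.IsPrime → (2 : 𝓞 K) ∈ P → P ^ 2 ≤ Ideal.span {2})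
    (d : ℕ) (hd4 : d % 4 = 3) (t : K) (ht : t ^ 2 = d)
    (w : L) (h : QuadExt K L w 2) :
    IsTotallyReal L ∧ Odd (Nat.card (ClassGroup (𝓞 L))) ∧
    (∀ P Q : Ideal (𝓞 L), P.IsPrime → Q.IsPrime → (2 : 𝓞 L) ∈ P → (2 : 𝓞 L) ∈ Q → P = Q) := by
  obtain ⟨hG, hdeg, τ, hτ, hτ1, hτt⟩ := h.setup
  have hTR : IsTotallyReal L := h.totReal (fun φ => ⟨2, by positivity, by rw [map_ofNat]; norm_num⟩)
  have hw2 : w ^ 2 = 2 := by rw [h.sq, map_ofNat]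
  obtain ⟨R, hR, hR2⟩ := exists_quad w 0 2 (by
    rw [map_zero, map_ofNat, hw2]; ring)
  have hR2' : R * R = 2 := by rw [← sq, hR2]; ring
  have hτR : τ • R = -R := by
    apply injO
    rw [coe_smulO, hR, map_neg, hR, hτt]
  obtain ⟨P0, hP0p, hP0⟩ := exists_prime_over (L := K) 2 Nat.prime_two
  have hmain := main_odd τ hτ hτ1 {P0} (by
    intro P hP hPb hPT
    refine ⟨R, fun hm => hPT ?_⟩
    rw [Finset.mem_singleton]
    rw [hτR] at hm
    have hm2 : (2 : 𝓞 L) ∈ P := by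
      have : (2 : 𝓞 L) * R ∈ P := by
        have : (2 : 𝓞 L) * R = -(-R - R) := by ring
        rw [this]; exact P.neg_mem hm
      rcases hP.mem_or_mem this with h2 | h2
      · exact h2
      · rw [← hR2']; exact P.mul_mem_left _ h2
    exact hu _ _ inferInstance hP0p
      (by exact_mod_cast nat_mem_under (K := K) P 2 (by exact_mod_cast hm2))
      (by exact_mod_cast hP0))
    hK hdeg {1} (by simp) (by simp) (by
      intro u hu v hv huv
      rw [Finset.mem_singleton] at hu hv
      exact absurd (hu.trans hv.symm) huv)
  refine ⟨hTR, hmain.1, uniq_two τ hτ hu ?_⟩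
  intro P hP h2
  by_contra hs
  have hPb : P ≠ ⊥ := mem_ne_bot 2 two_ne_zero P (by exact_mod_cast h2)
  have h4 : Ideal.map (algebraMap (𝓞 K) (𝓞 L)) (P.under (𝓞 K)) = P * τ • P := by
    rcases tri τ hτ hτ1 P hPb with ⟨h3, h4⟩ | ⟨h3, _⟩ | ⟨h3, _⟩
    · exact h4
    · exact absurd h3 hs
    · exact absurd h3 hs
  set p := P.under (𝓞 K) with hp
  have hp2 : (2 : 𝓞 K) ∈ p := by
    exact_mod_cast nat_mem_under (K := K) P 2 (by exact_mod_cast h2)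
  have hpp : p.IsPrime := inferInstance
  obtain ⟨k, hk⟩ : ∃ k : ℤ, (d : ℤ) = 4 * k + 3 := ⟨(d : ℤ) / 4, by omega⟩
  have hkK : (d : K) = 4 * (k : K) + 3 := by exact_mod_cast congrArg (Int.cast : ℤ → K) hk
  obtain ⟨t', ht', ht2⟩ := exists_quad t 0 (d : 𝓞 K) (by rw [map_zero, map_natCast, ht]; ring)
  have ht2' : t' * t' = 4 * (k : 𝓞 K) + 3 := by
    rw [← sq, ht2]
    have : (d : 𝓞 K) = 4 * (k : 𝓞 K) + 3 := by exact_mod_cast congrArg (Int.cast : ℤ → 𝓞 K) hk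
    rw [this]; ring
  have hw0 : w ≠ 0 := by
    rintro rfl
    norm_num at hw2
  have htL : (algebraMap K L t) ^ 2 = 4 * (k : L) + 3 := by
    rw [← map_pow, ht, hkK]; simp only [map_add, map_mul, map_ofNat, map_intCast]
  obtain ⟨E, hE, hE2⟩ := exists_quad ((1 + algebraMap K L t) / w) 0
      (algebraMap (𝓞 K) (𝓞 L) (2 * k + 2 + t')) (by
    rw [map_zero, algO, div_pow, hw2]
    simp only [map_ofNat, map_intCast, map_add, map_mul, ht']
    linear_combination htL / 2)
  have hτE : τ • E = -E := by
    apply injO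
    rw [coe_smulO, hE, map_neg, hE, map_div₀, hτt, map_add, map_one, AlgEquiv.commutes, div_neg]
  -- `v = 1 - κ`
  have hv : (2 * k + 1 + t' : 𝓞 K) ∈ p := by
    apply hpp.mem_of_pow_mem 2
    have : (2 * k + 1 + t' : 𝓞 K) ^ 2 =
        2 * ((2 * k + 1) * t' + (2 * k ^ 2 + 4 * k + 2)) := by
      linear_combination ht2'
    rw [this]; exact p.mul_mem_right _ hp2
  have hxx : (E - 1) * (E + 1) = algebraMap (𝓞 K) (𝓞 L) (2 * k + 1 + t') := by
    have : (2 * k + 2 + t' : 𝓞 K) = (2 * k + 1 + t') + 1 := by ring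
    rw [this, map_add, map_one] at hE2
    linear_combination hE2
  have hmem : ∀ Q : Ideal (𝓞 L), Q.IsPrime → (2 : 𝓞 L) ∈ Q →
      algebraMap (𝓞 K) (𝓞 L) (2 * k + 1 + t') ∈ Q → E - 1 ∈ Q := by
    intro Q hQ hQ2 hQv
    rw [← hxx] at hQv
    rcases hQ.mem_or_mem hQv with h5 | h5
    · exact h5
    · have : E - 1 = E + 1 - 2 := by ring
      rw [this]; exact Q.sub_mem h5 hQ2
  have hs2 : (2 : 𝓞 L) ∈ τ • P := by
    exact_mod_cast nat_mem_smul τ P 2 (by exact_mod_cast h2)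
  have hsp : algebraMap (𝓞 K) (𝓞 L) (2 * k + 1 + t') ∈ τ • P := by
    rw [← under_smul τ P] at hp
    rw [hp] at hv
    exact hv
  have hin := split_inter τ P hPb hs (E - 1) (hmem P hP h2 hv)
    (hmem _ (isPrime_smulI τ P) hs2 hsp)
  have h2in : (2 : 𝓞 L) ∈ P * τ • P := split_inter τ P hPb hs _ h2 hs2
  have hin2 : E + 1 ∈ P * τ • P := by
    have : E + 1 = (E - 1) + 2 := by ring
    rw [this]; exact Ideal.add_mem _ hin h2in
  have hprod := Ideal.mul_mem_mul hin hin2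
  rw [hxx, ← h4, ← Ideal.map_mul, ← sq] at hprod
  have h5 : Ideal.map (algebraMap (𝓞 K) (𝓞 L)) (p ^ 2) ≤ Ideal.span {2} := by
    refine (Ideal.map_mono (hsq p hpp hp2)).trans ?_
    rw [Ideal.map_span, Set.image_singleton, map_ofNat]
  obtain ⟨z, hz⟩ := Ideal.mem_span_singleton.1 (h5 hprod)
  have hz2 : algebraMap (𝓞 K) (𝓞 L) (2 * k + 1 - t') = 2 * (z - algebraMap (𝓞 K) (𝓞 L) t') := by
    have : (2 * k + 1 - t' : 𝓞 K) = (2 * k + 1 + t') - 2 * t' := by ring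
    rw [this, map_sub, hz, map_mul, map_ofNat]; ring
  have := rat_int L ((2 * k + 1) ^ 2 - (4 * k + 3)) 4 (by norm_num)
    (z * (z - algebraMap (𝓞 K) (𝓞 L) t')) (by
      have h6 : (((2 * k + 1) ^ 2 - (4 * k + 3) : ℤ) : 𝓞 L) =
        algebraMap (𝓞 K) (𝓞 L) (2 * k + 1 + t') * algebraMap (𝓞 K) (𝓞 L) (2 * k + 1 - t') := by
        rw [← map_mul]
        have : ((2 * k + 1 + t') * (2 * k + 1 - t') : 𝓞 K) =
            (((2 * k + 1) ^ 2 - (4 * k + 3) : ℤ) : 𝓞 K) := by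
          push_cast; linear_combination -ht2'
        rw [this, map_intCast]
      rw [h6, hz, hz2]; push_cast; ring)
  have h7 : (2 * k + 1) ^ 2 - (4 * k + 3) = 4 * (k * k) - 2 := by ring
  omega
end StepD
end PartP5d

section PartP5e
open NumberField
open scoped Pointwise nonZeroDivisors

section StepE
set_option linter.unusedSectionVars false
variable {K L : Type*} [Field K] [NumberField K] [Field L] [NumberField L] [Algebra K L]

/-- The inductive data carried along the tower. -/
structure St (K : Type*) [Field K] [NumberField K] (c : K) : Prop where
  tr : IsTotallyReal K
  odd : Odd (Nat.card (ClassGroup (𝓞 K)))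
  uq : ∀ P Q : Ideal (𝓞 K), P.IsPrime → Q.IsPrime → (2 : 𝓞 K) ∈ P → (2 : 𝓞 K) ∈ Q → P = Q
  pr : ∃ C : 𝓞 K, algebraMap (𝓞 K) K C = c ∧ ∀ P : Ideal (𝓞 K), P.IsPrime →
    (2 + C ∈ P → (2 : 𝓞 K) ∈ P) ∧ (2 - C ∈ P → (2 : 𝓞 K) ∈ P)
  sg : ∃ (s : K) (σ : K →+* K), (∀ x, σ (σ x) = x) ∧ σ c = -c ∧ σ s = -s ∧ s ^ 2 = 4 - c ^ 2

/-- the lift of `σ` sending `x` to `y`. -/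
lemma QuadExt.lift {x y : L} {m : K} (h : QuadExt K L x m) (σ : K →+* K)
    (hy : y ^ 2 = algebraMap K L (σ m)) :
    ∃ τ : L →+* L, τ x = y ∧ ∀ a, τ (algebraMap K L a) = algebraMap K L (σ a) := by
  choose A B hAB using h.gen
  have key : ∀ a b : K, A (algebraMap K L a + algebraMap K L b * x) = a ∧
      B (algebraMap K L a + algebraMap K L b * x) = b := fun a b => by
    have := h.uniq (hAB (algebraMap K L a + algebraMap K L b * x))
    exact ⟨this.1.symm, this.2.symm⟩
  let f : L → L := fun z => algebraMap K L (σ (A z)) + algebraMap K L (σ (B z)) * y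
  have hf : ∀ a b : K, f (algebraMap K L a + algebraMap K L b * x) =
      algebraMap K L (σ a) + algebraMap K L (σ b) * y := by
    intro a b
    simp only [f, (key a b).1, (key a b).2]
  have hfa : ∀ a, f (algebraMap K L a) = algebraMap K L (σ a) := by
    intro a
    have := hf a 0
    simpa using this
  let τ : L →+* L :=
    { toFun := f
      map_one' := by have := hfa 1; simpa using this
      map_zero' := by have := hfa 0; simpa using this
      map_add' := by
        intro z w
        obtain ⟨a, b, rfl⟩ := h.gen z
        obtain ⟨a', b', rfl⟩ := h.gen w
        have e : algebraMap K L a + algebraMap K L b * x + (algebraMap K L a' + algebraMap K L b' * x)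
          = algebraMap K L (a + a') + algebraMap K L (b + b') * x := by
          simp only [map_add]; ring
        rw [e, hf, hf, hf]
        simp only [map_add]; ring
      map_mul' := by
        intro z w
        obtain ⟨a, b, rfl⟩ := h.gen z
        obtain ⟨a', b', rfl⟩ := h.gen w
        have e : (algebraMap K L a + algebraMap K L b * x) *
            (algebraMap K L a' + algebraMap K L b' * x)
          = algebraMap K L (a * a' + b * b' * m) + algebraMap K L (a * b' + b * a') * x := by
          simp only [map_add, map_mul, ← h.sq]; ring
        rw [e, hf, hf, hf]
        simp only [map_add, map_mul, ← hy]; ring }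
  refine ⟨τ, ?_, hfa⟩
  have := hf 0 1
  have h2 : f x = y := by simpa using this
  exact h2

lemma stepE {c : K} (hS : St K c) (c' : L) (h2 : c' ^ 2 = algebraMap K L (2 + c))
    (hgen : ∀ y : L, ∃ a b : K, y = algebraMap K L a + algebraMap K L b * c') : St L c' := by
  obtain ⟨hTRK, hodd, huq, ⟨C, hC, hCP⟩, s, σ, hσσ, hσc, hσs, hs⟩ := hS
  have hc4 : c ^ 2 ≠ 4 := by
    intro h4
    have h5 : c ^ 2 = 2 ^ 2 := by rw [h4]; norm_num
    have h6 : c = 0 := by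
      have h7 : σ c = c := by
        rcases sq_eq_sq_iff_eq_or_eq_neg.1 h5 with h | h
        · rw [h, map_ofNat]
        · rw [h, map_neg, map_ofNat]
      rw [hσc] at h7
      exact self_eq_neg.1 h7.symm
    rw [h6] at h4
    norm_num at h4
  have hs0 : s ≠ 0 := by
    rintro rfl
    apply hc4
    linear_combination hs
  have hQ : QuadExt K L c' (2 + c) := by
    refine ⟨h2, ?_, hgen⟩
    intro a ha
    have ha2 : a ^ 2 = 2 + c := by
      apply (algebraMap K L).injective
      rw [map_pow, ha, h2]
    have ha3 : (σ a) ^ 2 = 2 - c := by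
      rw [← map_pow, ha2, map_add, map_ofNat, hσc]; ring
    have h4 : s ^ 2 = (a * σ a) ^ 2 := by
      rw [mul_pow, ha2, ha3, hs]; ring
    have h5 : σ s = s := by
      rcases sq_eq_sq_iff_eq_or_eq_neg.1 h4 with h | h
      · rw [h, map_mul, hσσ, mul_comm]
      · rw [h, map_neg, map_mul, hσσ, mul_comm]
    rw [hσs] at h5
    exact hs0 (self_eq_neg.1 h5.symm)
  obtain ⟨hG, hdeg, ρ, hρ, hρ1, hρc⟩ := hQ.setup
  have hTR : IsTotallyReal L := hQ.totReal (fun φ => by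
    have hK := IsTotallyReal.complexEmbedding_isReal φ
    rw [ComplexEmbedding.isReal_iff] at hK
    obtain ⟨x, hx⟩ := Complex.conj_eq_iff_real.1 (RingHom.congr_fun hK c)
    obtain ⟨y, hy⟩ := Complex.conj_eq_iff_real.1 (RingHom.congr_fun hK s)
    have h3 : y ^ 2 = 4 - x ^ 2 := by
      have := congrArg φ hs
      rw [map_pow, map_sub, map_pow, map_ofNat, hx, hy] at this
      exact_mod_cast this
    refine ⟨2 + x, ?_, by rw [map_add, map_ofNat, hx]; push_cast; rfl⟩
    nlinarith [sq_nonneg y, sq_nonneg x])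
  have hc'0 : c' ≠ 0 := by
    rintro rfl
    exact hQ.nmem 0 (map_zero _)
  obtain ⟨R, hR, hR2⟩ := exists_quad c' 0 (algebraMap (𝓞 K) (𝓞 L) (2 + C)) (by
    rw [map_zero, algO, map_add, map_ofNat, hC, h2]; ring)
  have hR2' : R * R = algebraMap (𝓞 K) (𝓞 L) (2 + C) := by rw [← sq, hR2]; ring
  have hρR : ρ • R = -R := by
    apply injO
    rw [coe_smulO, hR, map_neg, hR, hρc]
  have hdown : ∀ P : Ideal (𝓞 L), (2 : 𝓞 L) ∈ P → (2 : 𝓞 K) ∈ P.under (𝓞 K) := fun P hP => by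
    exact_mod_cast nat_mem_under (K := K) P 2 (by exact_mod_cast hP)
  have hup : ∀ P : Ideal (𝓞 L), (2 : 𝓞 K) ∈ P.under (𝓞 K) → (2 : 𝓞 L) ∈ P := fun P hP => by
    rw [Ideal.under_def, Ideal.mem_comap, map_ofNat] at hP; exact hP
  obtain ⟨P0, hP0p, hP0⟩ := exists_prime_over (L := K) 2 Nat.prime_two
  have hmain := main_odd ρ hρ hρ1 {P0} (by
    intro P hP hPb hPT
    refine ⟨R, fun hm => hPT ?_⟩
    rw [Finset.mem_singleton]
    rw [hρR] at hm
    have hm2 : (2 : 𝓞 L) ∈ P := by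
      have : (2 : 𝓞 L) * R ∈ P := by
        have : (2 : 𝓞 L) * R = -(-R - R) := by ring
        rw [this]; exact P.neg_mem hm
      rcases hP.mem_or_mem this with h2 | h2
      · exact h2
      · apply hup
        apply (hCP _ inferInstance).1
        rw [Ideal.under_def, Ideal.mem_comap, ← hR2']; exact P.mul_mem_left _ h2
    exact huq _ _ inferInstance hP0p (hdown P hm2) (by exact_mod_cast hP0))
    hodd hdeg {1} (by simp) (by simp) (by
      intro u hu v hv huv
      rw [Finset.mem_singleton] at hu hv
      exact absurd (hu.trans hv.symm) huv)
  set s' : L := algebraMap K L s / c' with hs'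
  have hs'c : s' * c' = algebraMap K L s := div_mul_cancel₀ _ hc'0
  have hs'2 : s' ^ 2 = algebraMap K L (2 - c) := by
    have h5 : algebraMap K L (2 + c) ≠ 0 := by rw [← h2]; exact pow_ne_zero _ hc'0
    rw [hs', div_pow, ← map_pow, hs, h2, div_eq_iff h5, ← map_mul]
    congr 1; ring
  have hs'0 : s' ≠ 0 := by
    intro h0
    rw [h0, zero_mul] at hs'c
    exact hs0 ((map_eq_zero _).1 hs'c.symm)
  have hρρ : ∀ x, ρ (ρ x) = x := by
    intro x
    obtain ⟨a, b, rfl⟩ := hgen x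
    simp [hρc]
  obtain ⟨τ, hτc, hτa⟩ := hQ.lift (y := s') σ (by
    rw [hs'2, map_add, map_ofNat, hσc]; congr 1; ring)
  have hτs : τ s' = -c' := by
    have := congrArg τ hs'c
    rw [map_mul, hτc, hτa, hσs, map_neg, ← hs'c] at this
    apply mul_right_cancel₀ hs'0
    rw [this]; ring
  have hττ : ∀ x, τ (τ x) = ρ x := by
    intro x
    obtain ⟨a, b, rfl⟩ := hgen x
    simp only [map_add, map_mul, hτa, hτc, hτs, hσσ, AlgEquiv.commutes, hρc]
  let θ : 𝓞 L →+* 𝓞 L := RingOfIntegers.mapRingHom τ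
  have hθθ : ∀ x : 𝓞 L, θ (θ x) = ρ • x := by
    intro x
    apply injO
    exact hττ _
  have hθsurj : Function.Surjective θ := by
    intro y
    refine ⟨θ (ρ • y), ?_⟩
    rw [hθθ, smul_smul_sig ρ hρ hρ1]
  have hsm : ∀ P : Ideal (𝓞 L), ρ • P = (P.comap θ).comap θ := by
    intro P
    ext x
    rw [mem_smul_iff2 ρ hρ hρ1, Ideal.mem_comap, Ideal.mem_comap, hθθ]
  refine ⟨hTR, hmain.1, uniq_two ρ hρ huq ?_, ⟨R, hR, ?_⟩, s', ρ, hρρ, hρc, ?_, ?_⟩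
  · intro P hP hP2
    have hP' : (P.comap θ).IsPrime := inferInstance
    have hP'2 : (2 : 𝓞 L) ∈ P.comap θ := by
      rw [Ideal.mem_comap, map_ofNat]; exact hP2
    have h1 := huq (P.under (𝓞 K)) ((P.comap θ).under (𝓞 K)) inferInstance inferInstance
      (hdown _ hP2) (hdown _ hP'2)
    rcases prime_trans ρ hρ P (P.comap θ) h1 with h | h
    · rw [hsm, h, h]
    · have h3 : P.comap θ = P := by
        apply Ideal.comap_injective_of_surjective θ hθsurj
        rw [← hsm, h]
      rw [← h, h3]
  · intro P hP
    have hk : (2 + R) * (2 - R) = algebraMap (𝓞 K) (𝓞 L) (2 - C) := by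
      rw [map_sub, map_ofNat]
      rw [map_add, map_ofNat] at hR2'
      linear_combination -hR2'
    have hk2 : (2 + R) * (2 - R) ∈ P → (2 : 𝓞 L) ∈ P := by
      intro h
      apply hup
      apply (hCP _ inferInstance).2
      rw [Ideal.under_def, Ideal.mem_comap, ← hk]; exact h
    exact ⟨fun h => hk2 (P.mul_mem_right _ h), fun h => hk2 (P.mul_mem_left _ h)⟩
  · change ρ s' = -s'
    rw [hs', map_div₀, hρc, AlgEquiv.commutes, div_neg]
  · rw [hs'2, h2, ← map_ofNat (algebraMap K L) 4, ← map_sub]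
    congr 1; ring

lemma stepD' [IsTotallyReal K] (hK : Odd (Nat.card (ClassGroup (𝓞 K))))
    (hu : ∀ P Q : Ideal (𝓞 K), P.IsPrime → Q.IsPrime → (2 : 𝓞 K) ∈ P → (2 : 𝓞 K) ∈ Q → P = Q)
    (hsq : ∀ P : Ideal (𝓞 K), P.IsPrime → (2 : 𝓞 K) ∈ P → P ^ 2 ≤ Ideal.span {2})
    (d : ℕ) (hd4 : d % 4 = 3) (t : K) (ht : t ^ 2 = d)
    (w : L) (h : QuadExt K L w 2) : St L w := by
  obtain ⟨h1, h2, h3⟩ := stepD hK hu hsq d hd4 t ht w h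
  obtain ⟨hG, hdeg, τ, hτ, hτ1, hτw⟩ := h.setup
  have hw2 : w ^ 2 = 2 := by rw [h.sq, map_ofNat]
  obtain ⟨R, hR, hR2⟩ := exists_quad w 0 2 (by rw [map_zero, map_ofNat, hw2]; ring)
  refine ⟨h1, h2, h3, ⟨R, hR, ?_⟩, w, τ, ?_, hτw, hτw, by rw [hw2]; norm_num⟩
  · intro P hP
    have hk : (2 + R) * (2 - R) = 2 := by linear_combination -hR2
    constructor
    · intro h; rw [← hk]; exact P.mul_mem_right _ h
    · intro h; rw [← hk]; exact P.mul_mem_left _ h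
  · intro x
    obtain ⟨a, b, rfl⟩ := h.gen x
    simp [hτw]
end StepE
end PartP5e

section PartP6
open NumberField

section Concrete

lemma gen_of (A B : IntermediateField ℚ ℝ) (x : ℝ) (hx2 : x ^ 2 ∈ A)
    (hB : ∀ C : IntermediateField ℚ ℝ, A ≤ C → x ∈ C → B ≤ C) (y : ℝ) (hy : y ∈ B) :
    ∃ a ∈ A, ∃ b ∈ A, y = a + b * x := by
  by_cases hxA : x ∈ A
  · exact ⟨y, hB A le_rfl hxA hy, 0, A.zero_mem, by ring⟩
  let C : IntermediateField ℚ ℝ :=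
    { carrier := {y | ∃ a ∈ A, ∃ b ∈ A, y = a + b * x}
      mul_mem' := by
        rintro _ _ ⟨a, ha, b, hb, rfl⟩ ⟨a', ha', b', hb', rfl⟩
        exact ⟨a * a' + b * b' * x ^ 2,
          A.add_mem (A.mul_mem ha ha') (A.mul_mem (A.mul_mem hb hb') hx2), a * b' + b * a',
          A.add_mem (A.mul_mem ha hb') (A.mul_mem hb ha'), by ring⟩
      add_mem' := by
        rintro _ _ ⟨a, ha, b, hb, rfl⟩ ⟨a', ha', b', hb', rfl⟩
        exact ⟨a + a', A.add_mem ha ha', b + b', A.add_mem hb hb', by ring⟩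
      algebraMap_mem' := fun r => ⟨_, A.algebraMap_mem r, 0, A.zero_mem, by ring⟩
      inv_mem' := by
        rintro _ ⟨a, ha, b, hb, rfl⟩
        by_cases h0 : a + b * x = 0
        · rw [h0, inv_zero]; exact ⟨0, A.zero_mem, 0, A.zero_mem, by ring⟩
        have h1 : a - b * x ≠ 0 := by
          intro h1
          have hb0 : b ≠ 0 := by
            rintro rfl
            apply h0; linear_combination h1
          apply hxA
          have : x = a / b := by rw [eq_div_iff hb0]; linear_combination -h1
          rw [this]; exact A.div_mem ha hb
        have hn : a ^ 2 - b ^ 2 * x ^ 2 ∈ A :=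
          A.sub_mem (A.pow_mem ha 2) (A.mul_mem (A.pow_mem hb 2) hx2)
        refine ⟨a / (a ^ 2 - b ^ 2 * x ^ 2), A.div_mem ha hn, -b / (a ^ 2 - b ^ 2 * x ^ 2),
          A.div_mem (A.neg_mem hb) hn, ?_⟩
        have h2 : a ^ 2 - b ^ 2 * x ^ 2 = (a + b * x) * (a - b * x) := by ring
        rw [h2]
        field_simp
        ring }
  exact hB C (fun z hz => ⟨z, hz, 0, A.zero_mem, by ring⟩)
    ⟨0, A.zero_mem, 1, A.one_mem, by ring⟩ hy

lemma nf_of (A B : IntermediateField ℚ ℝ) (x : ℝ) (hAB : A ≤ B) (hx : x ∈ B)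
    (hgen : ∀ y ∈ B, ∃ a ∈ A, ∃ b ∈ A, y = a + b * x) [hA : NumberField A] : NumberField B := by
  have hfA : Module.Finite ℚ A := hA.to_finiteDimensional
  let f : (A × A) →ₗ[ℚ] B :=
    { toFun := fun z => ⟨z.1 + z.2 * x,
        B.add_mem (hAB z.1.2) (B.mul_mem (hAB z.2.2) hx)⟩
      map_add' := by
        intro z w
        ext
        simp; ring
      map_smul' := by
        intro c z
        ext
        simp [Rat.smul_def]; ring }
  have hf : Function.Surjective f := by
    rintro ⟨y, hy⟩
    obtain ⟨a, ha, b, hb, rfl⟩ := hgen y hy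
    exact ⟨(⟨a, ha⟩, ⟨b, hb⟩), rfl⟩
  exact { to_charZero := inferInstance
          to_finiteDimensional := Module.Finite.of_surjective f hf }

lemma nf_bot : NumberField (⊥ : IntermediateField ℚ ℝ) :=
  { to_charZero := inferInstance
    to_finiteDimensional := by
      have : Module.Finite ℚ (⊥ : IntermediateField ℚ ℝ) := inferInstance
      exact this }

lemma not_sq_rat (n : ℕ) (h : Squarefree n) (h1 : n ≠ 1) : ¬ IsSquare (n : ℚ) := by
  rw [Rat.isSquare_natCast_iff]
  rintro ⟨k, hk⟩
  have := h k (by rw [hk])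
  rw [Nat.isUnit_iff] at this
  apply h1; rw [hk, this]

/-- inclusion as an algebra -/
@[reducible] noncomputable def incAlg (A B : IntermediateField ℚ ℝ) (h : A ≤ B) : Algebra A B :=
  (IntermediateField.inclusion h).toRingHom.toAlgebra

/-- inductive state for a real field -/
def StR (A : IntermediateField ℚ ℝ) (c : ℝ) : Prop :=
  ∃ (_ : NumberField A) (hc : c ∈ A), St A ⟨c, hc⟩

lemma StR_step (A B : IntermediateField ℚ ℝ) (c x : ℝ) (hS : StR A c) (hAB : A ≤ B) (hx : x ∈ B)
    (hxc : x ^ 2 = 2 + c)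
    (hB : ∀ C : IntermediateField ℚ ℝ, A ≤ C → x ∈ C → B ≤ C) : StR B x := by
  obtain ⟨hA, hc, hS⟩ := hS
  have hx2 : x ^ 2 ∈ A := by rw [hxc]; exact A.add_mem (by exact_mod_cast A.natCast_mem 2) hc
  have hgen := gen_of A B x hx2 hB
  have hNB := nf_of A B x hAB hx hgen
  let _i := incAlg A B hAB
  refine ⟨hNB, hx, stepE (K := A) (L := B) hS (⟨x, hx⟩ : B) ?_ ?_⟩
  · apply Subtype.ext
    exact hxc
  · rintro ⟨y, hy⟩
    obtain ⟨a, ha, b, hb, rfl⟩ := hgen y hy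
    exact ⟨⟨a, ha⟩, ⟨b, hb⟩, rfl⟩

end Concrete
end PartP6

section PartP7
section Final

lemma base (p d : ℕ) (hp : p.Prime) (hd : d.Prime) (hpd : p ≠ d)
    (hp8 : p % 8 = 5) (hd4 : d % 4 = 3) :
    Odd (Nat.card (ClassGroup (𝓞 (Qadj {Real.sqrt p, Real.sqrt d})))) ∧
    StR (Qadj {Real.sqrt p, Real.sqrt d, Real.sqrt 2}) (Real.sqrt 2) := by
  set A : IntermediateField ℚ ℝ := Qadj {Real.sqrt p} with hA
  set B : IntermediateField ℚ ℝ := Qadj {Real.sqrt p, Real.sqrt d} with hB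
  set C : IntermediateField ℚ ℝ := Qadj {Real.sqrt p, Real.sqrt d, Real.sqrt 2} with hC
  have hsp : (Real.sqrt p) ^ 2 = p := Real.sq_sqrt (by positivity)
  have hsd : (Real.sqrt d) ^ 2 = d := Real.sq_sqrt (by positivity)
  have hs2 : (Real.sqrt 2) ^ 2 = 2 := Real.sq_sqrt (by positivity)
  have hpA : Real.sqrt p ∈ A := IntermediateField.subset_adjoin ℚ _ (by simp)
  have hdB : Real.sqrt d ∈ B := IntermediateField.subset_adjoin ℚ _ (by simp)
  have h2C : Real.sqrt 2 ∈ C := IntermediateField.subset_adjoin ℚ _ (by simp)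
  have hAB : A ≤ B := IntermediateField.adjoin.mono ℚ _ _ (by simp)
  have hBC : B ≤ C := IntermediateField.adjoin.mono ℚ _ _ (by
    intro z hz
    simp only [Set.mem_insert_iff, Set.mem_singleton_iff] at hz ⊢
    tauto)
  have gA := gen_of ⊥ A (Real.sqrt p) (by rw [hsp]; exact IntermediateField.natCast_mem _ p) (by
    intro E _ h
    rw [hA, Qadj, IntermediateField.adjoin_le_iff]
    simpa using h)
  have gB := gen_of A B (Real.sqrt d) (by rw [hsd]; exact IntermediateField.natCast_mem _ d) (by
    intro E h1 h
    rw [hB, Qadj, IntermediateField.adjoin_le_iff]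
    rintro z (rfl | rfl)
    · exact h1 hpA
    · exact h)
  have gC := gen_of B C (Real.sqrt 2) (by
    rw [hs2]; exact_mod_cast IntermediateField.natCast_mem B 2) (by
    intro E h1 h
    rw [hC, Qadj, IntermediateField.adjoin_le_iff]
    rintro z (rfl | rfl | rfl)
    · exact h1 (hAB hpA)
    · exact h1 hdB
    · exact h)
  have := nf_bot
  have hNA := nf_of ⊥ A _ bot_le hpA gA
  have hNB := nf_of A B _ hAB hdB gB
  have hNC := nf_of B C _ hBC h2C gC
  let _i1 := incAlg A B hAB
  let _i2 := incAlg B C hBC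
  -- arithmetic
  have hp2 : p ≠ 2 := by omega
  have hd2 : d ≠ 2 := by omega
  have cpd : Nat.Coprime p d := (Nat.coprime_primes hp hd).2 hpd
  have c2p : Nat.Coprime 2 p := (Nat.coprime_primes Nat.prime_two hp).2 hp2.symm
  have c2d : Nat.Coprime 2 d := (Nat.coprime_primes Nat.prime_two hd).2 hd2.symm
  have sqp : Squarefree p := hp.prime.squarefree
  have sqd : Squarefree d := hd.prime.squarefree
  have sq2 : Squarefree 2 := Nat.prime_two.prime.squarefree
  have h1p : p ≠ 1 := hp.one_lt.ne'
  have h1d : d ≠ 1 := hd.one_lt.ne'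
  have sqdp : Squarefree (d * p) := (Nat.squarefree_mul cpd.symm).2 ⟨sqd, sqp⟩
  have sq2d : Squarefree (2 * d) := (Nat.squarefree_mul c2d).2 ⟨sq2, sqd⟩
  have sq2p : Squarefree (2 * p) := (Nat.squarefree_mul c2p).2 ⟨sq2, sqp⟩
  have sq2dp : Squarefree (2 * d * p) :=
    (Nat.squarefree_mul (Nat.Coprime.mul_left c2p cpd.symm)).2 ⟨sq2d, sqp⟩
  have qA : QuadExt ℚ A ⟨Real.sqrt p, hpA⟩ (p : ℚ) := by
    have hsq : (⟨Real.sqrt p, hpA⟩ : A) ^ 2 = algebraMap ℚ A (p : ℚ) := by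
      rw [map_natCast]
      apply Subtype.ext
      simp
    refine ⟨hsq, ?_, ?_⟩
    · intro a ha
      apply not_sq_rat p sqp h1p
      refine ⟨a, ?_⟩
      apply (algebraMap ℚ A).injective
      rw [← hsq, ← ha, map_mul, sq]
    · rintro ⟨y, hy⟩
      obtain ⟨a, ha, b, hb, rfl⟩ := gA y hy
      obtain ⟨a, rfl⟩ := IntermediateField.mem_bot.1 ha
      obtain ⟨b, rfl⟩ := IntermediateField.mem_bot.1 hb
      refine ⟨a, b, ?_⟩
      apply Subtype.ext
      simp
  have qB : QuadExt A B ⟨Real.sqrt d, hdB⟩ (d : A) := by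
    have hsq : (⟨Real.sqrt d, hdB⟩ : B) ^ 2 = algebraMap A B (d : A) := by
      rw [map_natCast]
      apply Subtype.ext
      simp
    refine ⟨hsq, ?_, ?_⟩
    · intro a ha
      have h : IsSquare (algebraMap ℚ A (d : ℚ)) := by
        refine ⟨a, ?_⟩
        apply (algebraMap A B).injective
        rw [map_natCast, ← hsq, ← ha, map_mul, sq]
      rcases qA.sqs h with h | h
      · exact not_sq_rat d sqd h1d h
      · exact not_sq_rat (d * p) sqdp (by simp [h1d]) (by exact_mod_cast h)
    · rintro ⟨y, hy⟩
      obtain ⟨a, ha, b, hb, rfl⟩ := gB y hy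
      exact ⟨⟨a, ha⟩, ⟨b, hb⟩, rfl⟩
  have qC : QuadExt B C ⟨Real.sqrt 2, h2C⟩ (2 : B) := by
    have hsq : (⟨Real.sqrt 2, h2C⟩ : C) ^ 2 = algebraMap B C (2 : B) := by
      rw [map_ofNat]
      apply Subtype.ext
      exact hs2
    refine ⟨hsq, ?_, ?_⟩
    · intro a ha
      have h : IsSquare (algebraMap A B (2 : A)) := by
        refine ⟨a, ?_⟩
        apply (algebraMap B C).injective
        rw [map_ofNat, ← hsq, ← ha, map_mul, sq]
      rcases qB.sqs h with h | h
      · have h' : IsSquare (algebraMap ℚ A (2 : ℚ)) := by rwa [map_ofNat]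
        rcases qA.sqs h' with h | h
        · exact not_sq_rat 2 sq2 (by norm_num) (by exact_mod_cast h)
        · exact not_sq_rat (2 * p) sq2p (by simp) (by exact_mod_cast h)
      · have h' : IsSquare (algebraMap ℚ A (2 * d : ℚ)) := by
          rwa [map_mul, map_ofNat, map_natCast]
        rcases qA.sqs h' with h | h
        · exact not_sq_rat (2 * d) sq2d (by simp) (by exact_mod_cast h)
        · exact not_sq_rat (2 * d * p) sq2dp (by simp) (by exact_mod_cast h)
    · rintro ⟨y, hy⟩
      obtain ⟨a, ha, b, hb, rfl⟩ := gC y hy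
      exact ⟨⟨a, ha⟩, ⟨b, hb⟩, rfl⟩
  obtain ⟨trA, oddA, galA, σ, hσ, hσ1, -, ⟨ε, hε⟩, h2A, hqA⟩ := stepA p hp hp8 _ qA
  obtain ⟨trB, oddB, uB, sB⟩ := stepB oddA σ hσ hσ1 ε hε h2A d hd hd4
    (fun P hP hdP => hqA P hP d hd hpd.symm hdP) _ qB
  refine ⟨oddB, hNC, h2C, ?_⟩
  refine stepD' oddB uB sB d hd4 ⟨Real.sqrt d, hdB⟩ ?_ _ qC
  apply Subtype.ext
  simp

lemma layer_zero (S : Set ℝ) : layer S 0 = Qadj S := by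
  have h : 2 * Real.cos (2 * Real.pi / 2 ^ (0 + 2)) = 0 := by
    have : 2 * Real.pi / 2 ^ (0 + 2) = Real.pi / 2 := by ring
    rw [this, Real.cos_pi_div_two, mul_zero]
  rw [layer, Qadj, h]
  apply le_antisymm
  · rw [IntermediateField.adjoin_le_iff]
    rintro z (hz | hz)
    · exact IntermediateField.subset_adjoin ℚ S hz
    · rw [Set.mem_singleton_iff.1 hz]
      exact IntermediateField.zero_mem _
  · exact IntermediateField.adjoin.mono ℚ _ _ (Set.subset_union_left)

lemma cos_one : 2 * Real.cos (2 * Real.pi / 2 ^ (1 + 2)) = Real.sqrt 2 := by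
  have : 2 * Real.pi / 2 ^ (1 + 2) = Real.pi / 4 := by ring
  rw [this, Real.cos_pi_div_four]; ring

lemma cos_succ (n : ℕ) : (2 * Real.cos (2 * Real.pi / 2 ^ (n + 1 + 2))) ^ 2 =
    2 + 2 * Real.cos (2 * Real.pi / 2 ^ (n + 2)) := by
  have : 2 * Real.pi / 2 ^ (n + 2) = 2 * (2 * Real.pi / 2 ^ (n + 1 + 2)) := by
    rw [show n + 1 + 2 = n + 2 + 1 by ring, pow_succ 2 (n + 2)]
    field_simp
  rw [this, Real.cos_two_mul]; ring

lemma layer_one (a b : ℝ) : layer {a, b} 1 = Qadj {a, b, Real.sqrt 2} := by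
  rw [layer, Qadj, cos_one]
  congr 1
  ext z
  simp only [Set.mem_union, Set.mem_insert_iff, Set.mem_singleton_iff]
  tauto

lemma layer_succ (S : Set ℝ) (n : ℕ)
    (h : StR (layer S n) (2 * Real.cos (2 * Real.pi / 2 ^ (n + 2)))) :
    StR (layer S (n + 1)) (2 * Real.cos (2 * Real.pi / 2 ^ (n + 1 + 2))) := by
  have hmem : 2 * Real.cos (2 * Real.pi / 2 ^ (n + 1 + 2)) ∈ layer S (n + 1) :=
    IntermediateField.subset_adjoin ℚ _ (by simp)
  refine StR_step _ _ _ _ h ?_ hmem (cos_succ n) ?_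
  · rw [layer, IntermediateField.adjoin_le_iff]
    rintro z (hz | hz)
    · exact IntermediateField.subset_adjoin ℚ _ (Or.inl hz)
    · rw [Set.mem_singleton_iff.1 hz]
      have : 2 * Real.cos (2 * Real.pi / 2 ^ (n + 2)) =
          (2 * Real.cos (2 * Real.pi / 2 ^ (n + 1 + 2))) ^ 2 - 2 := by rw [cos_succ]; ring
      rw [this]
      exact IntermediateField.sub_mem _ (IntermediateField.pow_mem _ hmem 2)
        (by exact_mod_cast IntermediateField.natCast_mem (layer S (n + 1)) 2)
  · intro E h1 h2
    rw [layer, IntermediateField.adjoin_le_iff]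
    rintro z (hz | hz)
    · exact h1 (IntermediateField.subset_adjoin ℚ _ (Or.inl hz))
    · rw [Set.mem_singleton_iff.1 hz]; exact h2

end Final
end PartP7

/-- Let p ≡ 5 (mod 8) and d ≡ 3 (mod 4) be primes with (d/p) = -1 or
p ≡ 5 (mod 8). Then the class number of the triquadratic field K₁ = Q(√p, √d, √2) is odd,
and consequently the 2-Iwasawa module A(K_∞) of K = Q(√p, √d) is trivial (equivalently,
since K_∞/K is totally ramified, all layers of the cyclotomic Z₂-extension of K have odd
class number). -/
theorem stmt18 (p d : ℕ) (hp : p.Prime) (hd : d.Prime) (hpd : p ≠ d)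
    (hp8 : p % 8 = 5) (hd4 : d % 4 = 3)
    (hcond : @legendreSym p ⟨hp⟩ (d : ℤ) = -1 ∨ p % 8 = 5) :
    Odd (Nat.card (ClassGroup
      (𝓞 (Qadj {Real.sqrt p, Real.sqrt d, Real.sqrt 2})))) ∧
    ∀ n : ℕ, Odd (Nat.card (ClassGroup
      (𝓞 (layer {Real.sqrt p, Real.sqrt d} n)))) := by
  obtain ⟨h0, h1⟩ := base p d hp hd hpd hp8 hd4
  have hall : ∀ n : ℕ, StR (layer {Real.sqrt p, Real.sqrt d} (n + 1))
      (2 * Real.cos (2 * Real.pi / 2 ^ (n + 1 + 2))) := by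
    intro n
    induction n with
    | zero =>
      rw [zero_add, layer_one, cos_one]; exact h1
    | succ n ih => exact layer_succ _ _ ih
  refine ⟨?_, ?_⟩
  · obtain ⟨_, _, h⟩ := h1
    exact h.odd
  · intro n
    cases n with
    | zero => rw [layer_zero]; exact h0
    | succ n =>
      obtain ⟨_, _, h⟩ := hall n
      exact h.odd
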